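/- arXiv:2412.17148 — 3 statements merged into one kernel-verified Lean document; each statement's English description precedes it below -/
import Mathlib

section
/- Let d ≥ 2 and 0 < α < d. There is a constant N = N(d, α) such that for every bounded measurable g : ℝ^d → ℝ with compact support, the pointwise inequality (P_α g)^#(x) ≤ N · M_α g(x) holds for all x ∈ ℝ^d. -/
open MeasureTheory ENNReal Metric Set

/-- The Riesz potential `P_α f (x) = ∫ f(y) / |x-y|^(d-α) dy`. -/
noncomputable def rieszPotential (d : ℕ) (α : ℝ) (f : EuclideanSpace ℝ (Fin d) → ℝ)
    (x : EuclideanSpace ℝ (Fin d)) : ℝ :=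
  ∫ y, f y / ‖x - y‖ ^ ((d : ℝ) - α)

/-- The fractional maximal function `M_β g (x) = sup_{ρ>0} ρ^β ⨍_{B_ρ(x)} |g|`. -/
noncomputable def fracMaximal (d : ℕ) (β : ℝ) (g : EuclideanSpace ℝ (Fin d) → ℝ)
    (x : EuclideanSpace ℝ (Fin d)) : ℝ≥0∞ :=
  ⨆ (ρ : ℝ) (_ : 0 < ρ), ENNReal.ofReal (ρ ^ β * ⨍ y in ball x ρ, |g y|)

/-- The Fefferman–Stein sharp function
`u^#(x) = sup_{ρ>0} ⨍_{B_ρ(x)} ⨍_{B_ρ(x)} |u(y) - u(z)| dy dz`. -/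
noncomputable def sharpFn (d : ℕ) (u : EuclideanSpace ℝ (Fin d) → ℝ)
    (x : EuclideanSpace ℝ (Fin d)) : ℝ≥0∞ :=
  ⨆ (ρ : ℝ) (_ : 0 < ρ),
    ENNReal.ofReal (⨍ y in ball x ρ, ⨍ z in ball x ρ, |u y - u z|)

theorem volume_ball_euclidean {d : ℕ} (x : EuclideanSpace ℝ (Fin d)) {r : ℝ} (hr : 0 < r) :
    volume (ball x r) =
      ENNReal.ofReal (r ^ (d : ℝ)) * volume (ball (0 : EuclideanSpace ℝ (Fin d)) 1) := by
  rw [Measure.addHaar_ball_of_pos _ _ hr, finrank_euclideanSpace_fin, Real.rpow_natCast]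

theorem rpow_neg_le_tsum_near {s r t : ℝ} (hs : 0 ≤ s) (ht : 0 < t) (htr : t < r) :
    ENNReal.ofReal (t ^ (-s)) ≤ ∑' n : ℕ, (Iio (2 * ((1 / 2) ^ n * r))).indicator
      (fun _ => ENNReal.ofReal (((1 / 2) ^ n * r / 2) ^ (-s))) t := by
  have hr : 0 < r := ht.trans htr
  obtain ⟨n, hn1, hn2⟩ := exists_nat_pow_near_of_lt_one (div_pos ht hr)
    ((div_le_one hr).2 htr.le) (by norm_num : (0 : ℝ) < 1 / 2) (by norm_num)
  rw [lt_div_iff₀ hr] at hn1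
  rw [div_le_iff₀ hr] at hn2
  refine le_trans ?_ (ENNReal.le_tsum n)
  rw [indicator_of_mem (by simp only [mem_Iio]; nlinarith)]
  refine ENNReal.ofReal_le_ofReal ?_
  refine Real.rpow_le_rpow_of_nonpos (by positivity) ?_ (by linarith)
  rw [pow_succ] at hn1
  linarith

theorem exists_lintegral_ball_rpow_neg_le {d : ℕ} {s : ℝ} (hs : 0 < s) (hsd : s < d) :
    ∃ A : ℝ≥0∞, A ≠ ⊤ ∧ ∀ (w : EuclideanSpace ℝ (Fin d)) (r : ℝ), 0 < r →
      ∫⁻ y in ball w r, ENNReal.ofReal (‖y - w‖ ^ (-s)) ≤ A * ENNReal.ofReal (r ^ ((d : ℝ) - s)) := by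
  set ω := volume (ball (0 : EuclideanSpace ℝ (Fin d)) 1) with hω
  have hωt : ω ≠ ⊤ := measure_ball_lt_top.ne
  set q : ℝ := (1 / 2) ^ ((d : ℝ) - s) with hq
  have hq0 : 0 ≤ q := by positivity
  have hq1 : q < 1 := Real.rpow_lt_one (by norm_num) (by norm_num) (by linarith)
  refine ⟨ENNReal.ofReal (2 ^ ((d : ℝ) + s)) * ω * (1 - ENNReal.ofReal q)⁻¹, ?_, ?_⟩
  · refine ENNReal.mul_ne_top (ENNReal.mul_ne_top ENNReal.ofReal_ne_top hωt) ?_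
    rw [ENNReal.inv_ne_top]
    exact (tsub_pos_of_lt (by simpa using hq1)).ne'
  intro w r hr
  calc ∫⁻ y in ball w r, ENNReal.ofReal (‖y - w‖ ^ (-s))
      ≤ ∫⁻ y in ball w r, ∑' n : ℕ, (ball w (2 * ((1 / 2) ^ n * r))).indicator
          (fun _ => ENNReal.ofReal (((1 / 2) ^ n * r / 2) ^ (-s))) y := by
        refine setLIntegral_mono' measurableSet_ball fun y hy => ?_
        rcases (norm_nonneg (y - w)).eq_or_lt with h0 | h0
        · rw [← h0, Real.zero_rpow (by linarith)]
          simp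
        · refine (rpow_neg_le_tsum_near hs.le h0 (mem_ball_iff_norm.1 hy)).trans (le_of_eq ?_)
          simp only [indicator, mem_Iio, mem_ball_iff_norm]
    _ ≤ ∫⁻ y, ∑' n : ℕ, (ball w (2 * ((1 / 2) ^ n * r))).indicator
          (fun _ => ENNReal.ofReal (((1 / 2) ^ n * r / 2) ^ (-s))) y := setLIntegral_le_lintegral _ _
    _ = ∑' n : ℕ, ENNReal.ofReal (((1 / 2) ^ n * r / 2) ^ (-s)) *
          (ENNReal.ofReal ((2 * ((1 / 2) ^ n * r)) ^ (d : ℝ)) * ω) := by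
        rw [lintegral_tsum fun n => (measurable_const.indicator measurableSet_ball).aemeasurable]
        refine tsum_congr fun n => ?_
        rw [lintegral_indicator_const measurableSet_ball, volume_ball_euclidean _ (by positivity)]
    _ = ∑' n : ℕ, (ENNReal.ofReal (2 ^ ((d : ℝ) + s)) * ω * ENNReal.ofReal (r ^ ((d : ℝ) - s))) *
          ENNReal.ofReal q ^ n := by
        refine tsum_congr fun n => ?_
        have key : ((1 / 2) ^ n * r / 2) ^ (-s) * (2 * ((1 / 2) ^ n * r)) ^ (d : ℝ) =
            2 ^ ((d : ℝ) + s) * r ^ ((d : ℝ) - s) * q ^ n := by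
          have hR : (0 : ℝ) < (1 / 2) ^ n * r := by positivity
          have e : q ^ n * r ^ ((d : ℝ) - s) = ((1 / 2) ^ n * r) ^ ((d : ℝ) - s) := by
            rw [Real.mul_rpow (by positivity) hr.le, hq, ← Real.rpow_natCast, ← Real.rpow_natCast,
              ← Real.rpow_mul (by norm_num), ← Real.rpow_mul (by norm_num), mul_comm (n : ℝ)]
          rw [mul_assoc, mul_comm (r ^ _), e, Real.div_rpow hR.le (by norm_num),
            Real.mul_rpow (by norm_num) hR.le, Real.rpow_add (by norm_num), sub_eq_neg_add,
            Real.rpow_add hR, Real.rpow_neg (by norm_num : (0 : ℝ) ≤ 2)]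
          field_simp
        rw [← ENNReal.ofReal_pow hq0, ← mul_assoc, ← ENNReal.ofReal_mul (by positivity), key,
          ENNReal.ofReal_mul (by positivity), ENNReal.ofReal_mul (by positivity)]
        ring
    _ = _ := by
        rw [ENNReal.tsum_mul_left, ENNReal.tsum_geometric]
        ring

theorem setLIntegral_ball_enorm_le_fracMaximal {d : ℕ} {α : ℝ}
    {g : EuclideanSpace ℝ (Fin d) → ℝ} (hg : Integrable g) (x : EuclideanSpace ℝ (Fin d))
    {r : ℝ} (hr : 0 < r) :
    ∫⁻ y in ball x r, ‖g y‖ₑ ≤ fracMaximal d α g x *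
      (ENNReal.ofReal (r ^ ((d : ℝ) - α)) * volume (ball (0 : EuclideanSpace ℝ (Fin d)) 1)) := by
  have h1 : ENNReal.ofReal (r ^ α * ⨍ y in ball x r, |g y|) ≤ fracMaximal d α g x :=
    le_iSup₂ (f := fun (ρ : ℝ) (_ : 0 < ρ) =>
      ENNReal.ofReal (ρ ^ α * ⨍ y in ball x ρ, |g y|)) r hr
  have h2 : ENNReal.ofReal (∫ y in ball x r, |g y|) = ∫⁻ y in ball x r, ‖g y‖ₑ := by
    simpa [Real.norm_eq_abs] using ofReal_integral_norm_eq_lintegral_enorm hg.restrict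
  have h3 : (∫ y in ball x r, |g y|) = volume.real (ball x r) * ⨍ y in ball x r, |g y| := by
    rw [setAverage_eq, smul_eq_mul, mul_inv_cancel_left₀]
    exact (ENNReal.toReal_pos (measure_ball_pos volume x hr).ne' measure_ball_lt_top.ne).ne'
  have h4 : volume.real (ball x r) * ⨍ y in ball x r, |g y| =
      (volume.real (ball x r) * r ^ (-α)) * (r ^ α * ⨍ y in ball x r, |g y|) := by
    rw [Real.rpow_neg hr.le]
    field_simp
  rw [← h2, h3, h4, ENNReal.ofReal_mul (by positivity), mul_comm]
  refine mul_le_mul' h1 (le_of_eq ?_)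
  rw [ENNReal.ofReal_mul (by positivity), ofReal_measureReal measure_ball_lt_top.ne,
    volume_ball_euclidean x hr, sub_eq_add_neg, Real.rpow_add hr, ENNReal.ofReal_mul (by positivity)]
  ring

theorem rpow_neg_le_tsum_far {s ρ t : ℝ} (hs : 0 ≤ s) (hρ : 0 < ρ) (ht : 2 * ρ ≤ t) :
    ENNReal.ofReal (ρ * t ^ (-s - 1)) ≤ ∑' n : ℕ, (Iio (2 * (2 ^ n * ρ))).indicator
      (fun _ => ENNReal.ofReal ((2 ^ n * ρ) ^ (-s)) * 2⁻¹ ^ n) t := by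
  obtain ⟨n, hn1, hn2⟩ := exists_nat_pow_near (x := t / ρ) (y := (2 : ℝ))
    (by rw [le_div_iff₀ hρ]; linarith) (by norm_num)
  rw [le_div_iff₀ hρ] at hn1
  rw [div_lt_iff₀ hρ, pow_succ] at hn2
  have hR : (0 : ℝ) < 2 ^ n * ρ := by positivity
  refine le_trans ?_ (ENNReal.le_tsum n)
  rw [indicator_of_mem (by simp only [mem_Iio]; linarith)]
  have h2 : (2⁻¹ : ℝ≥0∞) ^ n = ENNReal.ofReal (2⁻¹ ^ n) := by
    rw [ENNReal.ofReal_pow (by norm_num), ENNReal.ofReal_inv_of_pos (by norm_num)]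
    simp
  rw [h2, ← ENNReal.ofReal_mul (by positivity)]
  refine ENNReal.ofReal_le_ofReal ?_
  calc ρ * t ^ (-s - 1) ≤ ρ * (2 ^ n * ρ) ^ (-s - 1) := by
        exact mul_le_mul_of_nonneg_left
          (Real.rpow_le_rpow_of_nonpos hR hn1 (by linarith)) hρ.le
    _ = (2 ^ n * ρ) ^ (-s) * 2⁻¹ ^ n := by
        rw [Real.rpow_sub_one hR.ne', inv_pow]
        field_simp

theorem abs_rpow_neg_sub_rpow_neg_le {s m a b : ℝ} (hs : 0 ≤ s) (hm : 0 < m) (ha : m ≤ a)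
    (hb : m ≤ b) : |a ^ (-s) - b ^ (-s)| ≤ s * m ^ (-s - 1) * |a - b| := by
  have := Convex.norm_image_sub_le_of_norm_hasDerivWithin_le (f := fun t : ℝ => t ^ (-s))
    (f' := fun t => -s * t ^ (-s - 1)) (s := Ici m) (C := s * m ^ (-s - 1)) (x := b) (y := a)
    (fun t ht => (Real.hasDerivAt_rpow_const (Or.inl (hm.trans_le ht).ne')).hasDerivWithinAt)
    (fun t ht => ?_) (convex_Ici m) hb ha
  · simpa [Real.norm_eq_abs] using this
  · have ht' : m ≤ t := ht
    have h0 : 0 < t := hm.trans_le ht'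
    rw [norm_mul, norm_neg, Real.norm_of_nonneg hs, Real.norm_of_nonneg (by positivity)]
    gcongr s * ?_
    exact Real.rpow_le_rpow_of_nonpos hm ht' (by linarith)

theorem abs_rieszKernel_sub_le {E : Type*} [SeminormedAddCommGroup E] {s ρ : ℝ} (hs : 0 ≤ s)
    (hρ : 0 < ρ) {x y z w : E} (hy : y ∈ ball x ρ) (hz : z ∈ ball x ρ) (hw : 2 * ρ ≤ ‖w - x‖) :
    |‖y - w‖ ^ (-s) - ‖z - w‖ ^ (-s)| ≤
      s * 2 ^ (s + 2) * (ρ * ‖w - x‖ ^ (-s - 1)) := by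
  rw [mem_ball_iff_norm] at hy hz
  have h1 : ‖w - x‖ / 2 ≤ ‖y - w‖ := by
    have := norm_sub_le_norm_sub_add_norm_sub w y x
    rw [norm_sub_rev w y] at this
    linarith
  have h2 : ‖w - x‖ / 2 ≤ ‖z - w‖ := by
    have := norm_sub_le_norm_sub_add_norm_sub w z x
    rw [norm_sub_rev w z] at this
    linarith
  have hr : 0 < ‖w - x‖ := by linarith
  have h3 : |‖y - w‖ - ‖z - w‖| ≤ 2 * ρ := by
    refine (abs_norm_sub_norm_le _ _).trans ?_
    have := norm_sub_le_norm_sub_add_norm_sub y x z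
    rw [norm_sub_rev x z] at this
    rw [sub_sub_sub_cancel_right]
    linarith
  refine (abs_rpow_neg_sub_rpow_neg_le hs (half_pos hr) h1 h2).trans ?_
  calc s * (‖w - x‖ / 2) ^ (-s - 1) * |‖y - w‖ - ‖z - w‖|
      ≤ s * (‖w - x‖ / 2) ^ (-s - 1) * (2 * ρ) := by gcongr
    _ = _ := by
        rw [Real.div_rpow hr.le (by norm_num), (by ring : -s - 1 = -(s + 1)),
          Real.rpow_neg (by norm_num : (0 : ℝ) ≤ 2), (by ring : s + 2 = s + 1 + 1),
          Real.rpow_add_one (by norm_num : (2 : ℝ) ≠ 0) (s + 1)]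
        field_simp

theorem exists_lintegral_compl_ball_le_fracMaximal (d : ℕ) {s : ℝ} (hs : 0 < s) :
    ∃ B : ℝ≥0∞, B ≠ ⊤ ∧ ∀ g : EuclideanSpace ℝ (Fin d) → ℝ, Measurable g → Integrable g →
      ∀ (x : EuclideanSpace ℝ (Fin d)) (ρ : ℝ), 0 < ρ →
      ∫⁻ w in (ball x (2 * ρ))ᶜ, ‖g w‖ₑ * ENNReal.ofReal (ρ * ‖w - x‖ ^ (-s - 1)) ≤
        B * fracMaximal d (d - s) g x := by
  set ω := volume (ball (0 : EuclideanSpace ℝ (Fin d)) 1) with hω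
  have hωt : ω ≠ ⊤ := measure_ball_lt_top.ne
  refine ⟨ENNReal.ofReal (2 ^ s) * ω * 2,
    ENNReal.mul_ne_top (ENNReal.mul_ne_top ENNReal.ofReal_ne_top hωt) (by simp), ?_⟩
  intro g hg hgi x ρ hρ
  calc ∫⁻ w in (ball x (2 * ρ))ᶜ, ‖g w‖ₑ * ENNReal.ofReal (ρ * ‖w - x‖ ^ (-s - 1))
      ≤ ∫⁻ w in (ball x (2 * ρ))ᶜ, ∑' n : ℕ, (ball x (2 * (2 ^ n * ρ))).indicator
          (fun w => ENNReal.ofReal ((2 ^ n * ρ) ^ (-s)) * 2⁻¹ ^ n * ‖g w‖ₑ) w := by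
        refine setLIntegral_mono' measurableSet_ball.compl fun w hw => ?_
        have hw' : 2 * ρ ≤ ‖w - x‖ := by simpa [dist_eq_norm] using hw
        refine (mul_le_mul_right (rpow_neg_le_tsum_far hs.le hρ hw') _).trans (le_of_eq ?_)
        rw [← ENNReal.tsum_mul_left]
        refine tsum_congr fun n => ?_
        simp only [indicator, mem_Iio, mem_ball_iff_norm]
        split_ifs
        · rw [mul_comm]
        · simp
    _ ≤ ∫⁻ w, ∑' n : ℕ, (ball x (2 * (2 ^ n * ρ))).indicator
          (fun w => ENNReal.ofReal ((2 ^ n * ρ) ^ (-s)) * 2⁻¹ ^ n * ‖g w‖ₑ) w :=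
        setLIntegral_le_lintegral _ _
    _ = ∑' n : ℕ, ENNReal.ofReal ((2 ^ n * ρ) ^ (-s)) * 2⁻¹ ^ n *
          ∫⁻ w in ball x (2 * (2 ^ n * ρ)), ‖g w‖ₑ := by
        rw [lintegral_tsum fun n =>
          ((hg.enorm.const_mul _).indicator measurableSet_ball).aemeasurable]
        refine tsum_congr fun n => ?_
        rw [lintegral_indicator measurableSet_ball, lintegral_const_mul _ hg.enorm]
    _ ≤ ∑' n : ℕ, ENNReal.ofReal ((2 ^ n * ρ) ^ (-s)) * 2⁻¹ ^ n *
          (fracMaximal d (d - s) g x *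
            (ENNReal.ofReal ((2 * (2 ^ n * ρ)) ^ ((d : ℝ) - (d - s))) * ω)) := by
        refine ENNReal.tsum_le_tsum fun n => ?_
        gcongr
        exact setLIntegral_ball_enorm_le_fracMaximal hgi x (by positivity)
    _ = ∑' n : ℕ, (ENNReal.ofReal (2 ^ s) * ω * fracMaximal d (d - s) g x) * 2⁻¹ ^ n := by
        refine tsum_congr fun n => ?_
        have key : (2 ^ n * ρ) ^ (-s) * (2 * (2 ^ n * ρ)) ^ ((d : ℝ) - (d - s)) = 2 ^ s := by
          have hR : (0 : ℝ) < 2 ^ n * ρ := by positivity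
          rw [_root_.sub_sub_cancel, Real.mul_rpow (by norm_num) hR.le, Real.rpow_neg hR.le]
          field_simp
        rw [← key, ENNReal.ofReal_mul (by positivity)]
        ring
    _ = _ := by
        rw [ENNReal.tsum_mul_left, ENNReal.tsum_geometric, ENNReal.one_sub_inv_two, inv_inv]
        ring

theorem integrable_mul_rpow_neg {d : ℕ} {s : ℝ} (hs : 0 < s) (hsd : s < d)
    {g : EuclideanSpace ℝ (Fin d) → ℝ} (hg : Measurable g) (hgc : HasCompactSupport g) {C : ℝ}
    (hC : ∀ x, |g x| ≤ C) (y : EuclideanSpace ℝ (Fin d)) :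
    Integrable fun w => g w * ‖y - w‖ ^ (-s) := by
  obtain ⟨A, hA, hAle⟩ := exists_lintegral_ball_rpow_neg_le hs hsd
  obtain ⟨R, hR0, hR⟩ := hgc.isCompact.isBounded.subset_ball_lt 0 y
  have hm : Measurable fun w : EuclideanSpace ℝ (Fin d) => ‖y - w‖ ^ (-s) := by fun_prop
  refine ⟨(hg.mul hm).aestronglyMeasurable, ?_⟩
  calc ∫⁻ w, ‖g w * ‖y - w‖ ^ (-s)‖ₑ
      ≤ ∫⁻ w, (ball y R).indicator
          (fun w => ENNReal.ofReal C * ENNReal.ofReal (‖w - y‖ ^ (-s))) w := by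
        refine lintegral_mono fun w => ?_
        by_cases hw : w ∈ ball y R
        · rw [indicator_of_mem hw, enorm_mul, norm_sub_rev y w,
            Real.enorm_of_nonneg (by positivity : 0 ≤ ‖w - y‖ ^ (-s)), Real.enorm_eq_ofReal_abs]
          gcongr
          exact hC w
        · have : g w = 0 := by
            by_contra h
            exact hw (hR (subset_tsupport g h))
          simp [this]
    _ = ENNReal.ofReal C * ∫⁻ w in ball y R, ENNReal.ofReal (‖w - y‖ ^ (-s)) := by
        rw [lintegral_indicator measurableSet_ball, lintegral_const_mul' _ _ ENNReal.ofReal_ne_top]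
    _ ≤ ENNReal.ofReal C * (A * ENNReal.ofReal (R ^ ((d : ℝ) - s))) := by
        gcongr
        exact hAle y R hR0
    _ < ⊤ := ENNReal.mul_lt_top ENNReal.ofReal_lt_top
        (ENNReal.mul_lt_top hA.lt_top ENNReal.ofReal_lt_top)

theorem ofReal_average_le_laverage_enorm {X : Type*} [MeasurableSpace X] (μ : Measure X)
    (f : X → ℝ) : ENNReal.ofReal (⨍ x, f x ∂μ) ≤ ⨍⁻ x, ‖f x‖ₑ ∂μ :=
  (Real.ofReal_le_enorm _).trans (enorm_integral_le_lintegral_enorm _)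

theorem ofReal_average_average_abs_sub_le {X : Type*} [MeasurableSpace X] (μ : Measure X)
    (u : X → ℝ) :
    ENNReal.ofReal (⨍ y, ⨍ z, |u y - u z| ∂μ ∂μ) ≤ ⨍⁻ y, ⨍⁻ z, ‖u y - u z‖ₑ ∂μ ∂μ := by
  refine (ofReal_average_le_laverage_enorm μ _).trans (lintegral_mono fun y => ?_)
  refine (enorm_integral_le_lintegral_enorm _).trans (lintegral_mono fun z => ?_)
  simp

theorem enorm_rieszPotential_sub_le {d : ℕ} {s : ℝ} (hs : 0 < s) (hsd : s < d)
    {g : EuclideanSpace ℝ (Fin d) → ℝ} (hg : Measurable g) (hgc : HasCompactSupport g) {C : ℝ}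
    (hC : ∀ x, |g x| ≤ C) {x y z : EuclideanSpace ℝ (Fin d)} {ρ : ℝ} (hρ : 0 < ρ)
    (hy : y ∈ ball x ρ) (hz : z ∈ ball x ρ) :
    ‖rieszPotential d (d - s) g y - rieszPotential d (d - s) g z‖ₑ ≤
      (∫⁻ w in ball x (2 * ρ), ‖g w‖ₑ * ENNReal.ofReal (‖y - w‖ ^ (-s))) +
      (∫⁻ w in ball x (2 * ρ), ‖g w‖ₑ * ENNReal.ofReal (‖z - w‖ ^ (-s))) +
      ENNReal.ofReal (s * 2 ^ (s + 2)) *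
        ∫⁻ w in (ball x (2 * ρ))ᶜ, ‖g w‖ₑ * ENNReal.ofReal (ρ * ‖w - x‖ ^ (-s - 1)) := by
  have hu : ∀ v, rieszPotential d (d - s) g v = ∫ w, g w * ‖v - w‖ ^ (-s) := fun v => by
    simp only [rieszPotential, _root_.sub_sub_cancel]
    refine integral_congr_ae (Filter.Eventually.of_forall fun w => ?_)
    simp only [Real.rpow_neg (norm_nonneg _), div_eq_mul_inv]
  have hm : Measurable fun w : EuclideanSpace ℝ (Fin d) =>
      ‖g w‖ₑ * ENNReal.ofReal (‖y - w‖ ^ (-s)) := by fun_prop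
  rw [hu, hu, ← integral_sub (integrable_mul_rpow_neg hs hsd hg hgc hC y)
    (integrable_mul_rpow_neg hs hsd hg hgc hC z)]
  refine (enorm_integral_le_lintegral_enorm _).trans ?_
  rw [← lintegral_add_compl _ (measurableSet_ball (x := x) (ε := 2 * ρ)), ← lintegral_add_left hm,
    ← lintegral_const_mul' _ _ ENNReal.ofReal_ne_top]
  refine add_le_add (lintegral_mono fun w => ?_)
    (setLIntegral_mono' measurableSet_ball.compl fun w hw => ?_)
  · refine (enorm_sub_le).trans (le_of_eq ?_)
    simp only [enorm_mul]
    rw [Real.enorm_of_nonneg (by positivity : 0 ≤ ‖y - w‖ ^ (-s)),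
      Real.enorm_of_nonneg (by positivity : 0 ≤ ‖z - w‖ ^ (-s))]
  · have hw' : 2 * ρ ≤ ‖w - x‖ := by simpa [dist_eq_norm] using hw
    rw [← mul_sub, enorm_mul, mul_left_comm, ← ENNReal.ofReal_mul (by positivity),
      Real.enorm_eq_ofReal_abs (_ - _)]
    gcongr
    exact abs_rieszKernel_sub_le hs.le hρ hy hz hw'

theorem exists_setLAverage_lintegral_le_fracMaximal {d : ℕ} {s : ℝ} (hs : 0 < s) (hsd : s < d) :
    ∃ A : ℝ≥0∞, A ≠ ⊤ ∧ ∀ g : EuclideanSpace ℝ (Fin d) → ℝ, Measurable g → Integrable g →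
      ∀ (x : EuclideanSpace ℝ (Fin d)) (ρ : ℝ), 0 < ρ →
      ⨍⁻ y in ball x ρ,
        (∫⁻ w in ball x (2 * ρ), ‖g w‖ₑ * ENNReal.ofReal (‖y - w‖ ^ (-s))) ∂volume ≤
        A * fracMaximal d (d - s) g x := by
  obtain ⟨A, hA, hAle⟩ := exists_lintegral_ball_rpow_neg_le hs hsd
  set ω := volume (ball (0 : EuclideanSpace ℝ (Fin d)) 1) with hω
  refine ⟨A * ENNReal.ofReal (2 ^ s * 3 ^ ((d : ℝ) - s)),
    ENNReal.mul_ne_top hA ENNReal.ofReal_ne_top, ?_⟩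
  intro g hg hgi x ρ hρ
  rw [setLAverage_eq]
  refine ENNReal.div_le_of_le_mul ?_
  rw [lintegral_lintegral_swap (by
    refine Measurable.aemeasurable ?_
    unfold Function.uncurry
    fun_prop)]
  calc ∫⁻ w in ball x (2 * ρ), ∫⁻ y in ball x ρ, ‖g w‖ₑ * ENNReal.ofReal (‖y - w‖ ^ (-s))
      ≤ ∫⁻ w in ball x (2 * ρ), ‖g w‖ₑ * (A * ENNReal.ofReal ((3 * ρ) ^ ((d : ℝ) - s))) := by
        refine setLIntegral_mono' measurableSet_ball fun w hw => ?_
        rw [lintegral_const_mul' _ _ enorm_ne_top]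
        gcongr
        refine (lintegral_mono_set (ball_subset_ball' ?_)).trans (hAle w (3 * ρ) (by positivity))
        rw [mem_ball'] at hw
        linarith
    _ ≤ fracMaximal d (d - s) g x * (ENNReal.ofReal ((2 * ρ) ^ ((d : ℝ) - (d - s))) * ω) *
          (A * ENNReal.ofReal ((3 * ρ) ^ ((d : ℝ) - s))) := by
        rw [lintegral_mul_const _ hg.enorm]
        gcongr
        exact setLIntegral_ball_enorm_le_fracMaximal hgi x (by positivity)
    _ = _ := by
        have key : (2 * ρ) ^ ((d : ℝ) - (d - s)) * (3 * ρ) ^ ((d : ℝ) - s) =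
            2 ^ s * 3 ^ ((d : ℝ) - s) * ρ ^ (d : ℝ) := by
          have : ρ ^ (d : ℝ) = ρ ^ s * ρ ^ ((d : ℝ) - s) := by
            rw [← Real.rpow_add hρ, add_sub_cancel]
          rw [this, _root_.sub_sub_cancel, Real.mul_rpow (by norm_num) hρ.le,
            Real.mul_rpow (by norm_num) hρ.le]
          ring
        have key' := congrArg ENNReal.ofReal key
        rw [ENNReal.ofReal_mul (by positivity), ENNReal.ofReal_mul (by positivity)] at key'
        rw [volume_ball_euclidean x hρ]
        calc _ = fracMaximal d (d - s) g x * ω * A * (ENNReal.ofReal ((2 * ρ) ^ ((d : ℝ) - (d - s)))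
              * ENNReal.ofReal ((3 * ρ) ^ ((d : ℝ) - s))) := by ring
          _ = _ := by rw [key']; ring

theorem laverage_laverage_add_add {X : Type*} [MeasurableSpace X] (μ : Measure X)
    [IsFiniteMeasure μ] [NeZero μ] {f : X → ℝ≥0∞} (hf : Measurable f) (c : ℝ≥0∞) :
    ⨍⁻ y, ⨍⁻ z, (f y + f z + c) ∂μ ∂μ = 2 * (⨍⁻ y, f y ∂μ) + c := by
  have h : ∀ (a : ℝ≥0∞) {k : X → ℝ≥0∞}, Measurable k →
      ⨍⁻ z, (k z + a) ∂μ = (⨍⁻ z, k z ∂μ) + a := fun a k hk => by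
    rw [laverage, lintegral_add_left hk]
    congr 1
    exact laverage_const μ a
  have h1 : ∀ y, ⨍⁻ z, (f y + f z + c) ∂μ = f y + ((⨍⁻ z, f z ∂μ) + c) := fun y => by
    rw [h c (hf.const_add _)]
    simp only [add_comm (f y)]
    rw [h _ hf]
    ring
  simp only [h1]
  rw [h _ hf]
  ring

/-- `(P_α g)^# ≤ N · M_α g` pointwise, for bounded compactly supported `g`. -/
theorem sharp_riesz_le_fracMaximal (d : ℕ) (hd : 2 ≤ d) (α : ℝ)
    (hα0 : 0 < α) (hαd : α < d) :
    ∃ N : ℝ, 0 < N ∧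
      ∀ g : EuclideanSpace ℝ (Fin d) → ℝ,
        Measurable g → HasCompactSupport g → (∃ C : ℝ, ∀ x, |g x| ≤ C) →
        ∀ x, sharpFn d (rieszPotential d α g) x ≤
          ENNReal.ofReal N * fracMaximal d α g x := by
  obtain ⟨s, rfl⟩ : ∃ s : ℝ, α = d - s := ⟨d - α, by ring⟩
  have hs : 0 < s := by linarith
  have hsd : s < d := by linarith
  obtain ⟨A, hA, hAle⟩ := exists_setLAverage_lintegral_le_fracMaximal hs hsd
  obtain ⟨B, hB, hBle⟩ := exists_lintegral_compl_ball_le_fracMaximal d hs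
  set c := ENNReal.ofReal (s * 2 ^ (s + 2)) with hc
  have hfin : 2 * A + c * B ≠ ⊤ := ENNReal.add_ne_top.2
    ⟨ENNReal.mul_ne_top (by simp) hA, ENNReal.mul_ne_top ENNReal.ofReal_ne_top hB⟩
  refine ⟨(2 * A + c * B).toReal + 1, by positivity, ?_⟩
  rintro g hg hgc ⟨C, hC⟩ x
  have hgi : Integrable g :=
    (integrableOn_iff_integrable_of_support_subset (subset_tsupport g)).1
      (Measure.integrableOn_of_bounded hgc.isCompact.measure_lt_top.ne hg.aestronglyMeasurable
        (Filter.Eventually.of_forall hC))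
  have hN : 2 * A + c * B ≤ ENNReal.ofReal ((2 * A + c * B).toReal + 1) := by
    rw [← ENNReal.ofReal_toReal hfin]
    exact ENNReal.ofReal_le_ofReal (by simp)
  refine le_trans (iSup₂_le fun ρ hρ => ?_) (mul_le_mul_left hN _)
  set I : EuclideanSpace ℝ (Fin d) → ℝ≥0∞ := fun y =>
    ∫⁻ w in ball x (2 * ρ), ‖g w‖ₑ * ENNReal.ofReal (‖y - w‖ ^ (-s)) with hI
  set F := ∫⁻ w in (ball x (2 * ρ))ᶜ, ‖g w‖ₑ * ENNReal.ofReal (ρ * ‖w - x‖ ^ (-s - 1)) with hF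
  have hIm : Measurable I := by
    refine Measurable.lintegral_prod_right' (f := fun p :
      EuclideanSpace ℝ (Fin d) × EuclideanSpace ℝ (Fin d) =>
        ‖g p.2‖ₑ * ENNReal.ofReal (‖p.1 - p.2‖ ^ (-s))) ?_
    fun_prop
  have : IsFiniteMeasure (volume.restrict (ball x ρ)) := ⟨by simpa using measure_ball_lt_top⟩
  have : NeZero (volume.restrict (ball x ρ)) :=
    ⟨by simpa [Measure.restrict_eq_zero] using (measure_ball_pos volume x hρ).ne'⟩
  have hae : ∀ᵐ y ∂(volume.restrict (ball x ρ)), y ∈ ball x ρ := ae_restrict_mem measurableSet_ball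
  calc _ ≤ ⨍⁻ y in ball x ρ, (⨍⁻ z in ball x ρ,
        ‖rieszPotential d (d - s) g y - rieszPotential d (d - s) g z‖ₑ ∂volume) ∂volume :=
        ofReal_average_average_abs_sub_le _ _
    _ ≤ ⨍⁻ y in ball x ρ, (⨍⁻ z in ball x ρ, (I y + I z + c * F) ∂volume) ∂volume := by
        refine laverage_mono_ae ?_
        filter_upwards [hae] with y hy
        refine laverage_mono_ae ?_
        filter_upwards [hae] with z hz
        exact enorm_rieszPotential_sub_le hs hsd hg hgc hC hρ hy hz
    _ = 2 * (⨍⁻ y in ball x ρ, I y ∂volume) + c * F := laverage_laverage_add_add _ hIm _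
    _ ≤ 2 * (A * fracMaximal d (d - s) g x) + c * (B * fracMaximal d (d - s) g x) := by
        gcongr
        · exact hAle g hg hgi x ρ hρ
        · exact hBle g hg hgi x ρ hρ
    _ = _ := by ring
end

section
/- Let d ≥ 2 and 1 < p < d, and let b(x) = |x|^{-1}. Then there exists ε₀ = ε₀(d, p) > 0 such that for every constant C > 0 there exists a function u ∈ C_0^∞(ℝ^d) with ‖b |Du|‖_{L_p(ℝ^d)} > ε₀ ‖D²u‖_{L_p(ℝ^d)} + C ‖u‖_{L_p(ℝ^d)}; that is, the estimate ‖b|Du|‖_{L_p} ≤ ε‖D²u‖_{L_p} + N(ε)‖u‖_{L_p} cannot hold for all u ∈ C_0^∞ when ε ≤ ε₀, no matter how N(ε) is chosen. -/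
open MeasureTheory ENNReal Metric Set

/-- Pulling a nonnegative real factor out of an `L_p` norm. -/
lemma eLpNorm_nonneg_const_smul {α F : Type*} [MeasurableSpace α] [NormedAddCommGroup F]
    [NormedSpace ℝ F] (μ : Measure α) (g : α → F) (q : ℝ≥0∞) {c : ℝ} (hc : 0 ≤ c) :
    eLpNorm (fun x => c • g x) q μ = ENNReal.ofReal c * eLpNorm g q μ := by
  rw [← Real.enorm_of_nonneg hc, ← eLpNorm_const_smul, Pi.smul_def]

/-- Change of variables `x ↦ r • x` in an `L_p` norm. -/
lemma eLpNorm_comp_smul_addHaar {E F : Type*} [NormedAddCommGroup E] [NormedSpace ℝ E]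
    [MeasurableSpace E] [BorelSpace E] [FiniteDimensional ℝ E] [NormedAddCommGroup F]
    (μ : Measure E) [μ.IsAddHaarMeasure] (g : E → F) {q : ℝ≥0∞} (hq : q ≠ ∞)
    {r : ℝ} (hr : r ≠ 0) :
    eLpNorm (fun x => g (r • x)) q μ =
      ENNReal.ofReal |(r ^ Module.finrank ℝ E)⁻¹| ^ (1 / q).toReal * eLpNorm g q μ := by
  have h := (Homeomorph.smulOfNeZero (α := E) r hr).measurableEmbedding.eLpNorm_map_measure
    (μ := μ) (p := q) (g := g)
  have h2 := Measure.map_addHaar_smul μ hr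
  change eLpNorm g q (Measure.map (r • ·) μ) = eLpNorm (fun x => g (r • x)) q μ at h
  rw [← h, h2, eLpNorm_smul_measure_of_ne_top hq, smul_eq_mul]

/-- If a smooth compactly supported function is not identically zero, then neither is its
gradient in a weighted `L_p` space with weight `‖x‖⁻¹`. -/
lemma eLpNorm_inv_norm_mul_fderiv_ne_zero {E : Type*} [NormedAddCommGroup E] [NormedSpace ℝ E]
    [MeasurableSpace E] [BorelSpace E] [FiniteDimensional ℝ E] [Nontrivial E]
    (μ : Measure E) [μ.IsAddHaarMeasure] {u : E → ℝ} (hu : ContDiff ℝ 1 u)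
    (hc : HasCompactSupport u) (h0 : u ≠ 0) {q : ℝ≥0∞} (hq : q ≠ 0) :
    eLpNorm (fun x => ‖x‖⁻¹ * ‖fderiv ℝ u x‖) q μ ≠ 0 := by
  intro h
  have hcont : Continuous (fderiv ℝ u) := hu.continuous_fderiv one_ne_zero
  rw [eLpNorm_eq_zero_iff
    (show Measurable fun x => ‖x‖⁻¹ * ‖fderiv ℝ u x‖ from
      measurable_norm.inv.mul hcont.norm.measurable).aestronglyMeasurable hq] at h
  have hne : ∀ᵐ x ∂μ, x ≠ 0 := by simp [ae_iff]
  have hD : fderiv ℝ u =ᵐ[μ] fun _ => 0 := by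
    filter_upwards [h, hne] with x hx hx0
    simpa [hx0] using hx
  have hD' : fderiv ℝ u = fun _ => 0 := (hcont.ae_eq_iff_eq μ continuous_const).1 hD
  have hconst := is_const_of_fderiv_eq_zero (hu.differentiable one_ne_zero) (congrFun hD')
  have : NoncompactSpace E := NormedSpace.noncompactSpace ℝ E
  obtain ⟨y, hy⟩ : ∃ y, y ∉ tsupport u := by
    by_contra! hall
    exact noncompact_univ E (eq_univ_of_forall hall ▸ hc)
  exact h0 (funext fun x => (hconst x y).trans (image_eq_zero_of_notMem_tsupport hy))

/-- By scaling, no interpolation inequality with a small coefficient of the Hessian can hold for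
the weight `‖x‖⁻¹`, in any nontrivial finite-dimensional space. -/
lemma exists_pos_forall_exists_interpolation_lt {E : Type*} [NormedAddCommGroup E]
    [NormedSpace ℝ E] [MeasurableSpace E] [BorelSpace E] [FiniteDimensional ℝ E] [Nontrivial E]
    (μ : Measure E) [μ.IsAddHaarMeasure] {q : ℝ≥0∞} (hq0 : q ≠ 0) (hqt : q ≠ ∞) :
    ∃ ε₀ : ℝ, 0 < ε₀ ∧ ∀ C : ℝ, 0 < C → ∃ u : E → ℝ,
      ContDiff ℝ (⊤ : ℕ∞) u ∧ HasCompactSupport u ∧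
      ENNReal.ofReal ε₀ * eLpNorm (fun x => fderiv ℝ (fderiv ℝ u) x) q μ +
          ENNReal.ofReal C * eLpNorm u q μ <
        eLpNorm (fun x => ‖x‖⁻¹ * ‖fderiv ℝ u x‖) q μ := by
  let φ : ContDiffBump (0 : E) := default
  obtain ⟨v, hv, hvc, hv0⟩ : ∃ v : E → ℝ, ContDiff ℝ (⊤ : ℕ∞) v ∧ HasCompactSupport v ∧ v ≠ 0 :=
    ⟨φ, φ.contDiff, φ.hasCompactSupport, fun h =>
      one_ne_zero ((φ.one_of_mem_closedBall (mem_closedBall_self φ.rIn_pos.le)).symm.trans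
        (congrFun h 0))⟩
  have hDv : ContDiff ℝ (⊤ : ℕ∞) (fderiv ℝ v) := hv.fderiv_right (by simp)
  have ha := eLpNorm_inv_norm_mul_fderiv_ne_zero μ
    (hv.of_le (by exact_mod_cast le_top)) hvc hv0 hq0
  have hB : eLpNorm (fderiv ℝ (fderiv ℝ v)) q μ ≠ ∞ :=
    ((hDv.continuous_fderiv (by simp)).memLp_of_hasCompactSupport
      ((hvc.fderiv ℝ).fderiv ℝ)).eLpNorm_ne_top
  have hU : eLpNorm v q μ ≠ ∞ :=
    (hv.continuous.memLp_of_hasCompactSupport hvc).eLpNorm_ne_top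
  set a := eLpNorm (fun x : E => ‖x‖⁻¹ * ‖fderiv ℝ v x‖) q μ
  set B := eLpNorm (fderiv ℝ (fderiv ℝ v)) q μ
  set U := eLpNorm v q μ
  obtain ⟨m, hm0, hma⟩ : ∃ m : ℝ, 0 < m ∧ ENNReal.ofReal m < a := by
    obtain ⟨m, hm0, hma⟩ := ENNReal.lt_iff_exists_nnreal_btwn.1 (pos_iff_ne_zero.2 ha)
    exact ⟨m, by exact_mod_cast hm0, by simpa using hma⟩
  refine ⟨m / (2 * (B.toReal + 1)), by positivity, fun C hC => ?_⟩
  set ε := m / (2 * (B.toReal + 1)) with hε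
  have hεB : ε * B.toReal ≤ m / 2 := by
    rw [hε, div_mul_eq_mul_div, div_le_div_iff₀ (by positivity) (by positivity)]
    nlinarith
  obtain ⟨r, hr1, hr⟩ : ∃ r : ℝ, 1 ≤ r ∧ C * U.toReal ≤ r * (m / 2) := by
    refine ⟨max 1 (C * U.toReal / (m / 2)), le_max_left _ _, ?_⟩
    rw [← div_le_iff₀ (by positivity)]
    exact le_max_right _ _
  have hr0 : 0 < r := by linarith
  have hD1 (x : E) : fderiv ℝ (fun x => v (r • x)) x = r • fderiv ℝ v (r • x) :=
    fderiv_comp_smul r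
  have hD2 (x : E) : fderiv ℝ (fderiv ℝ fun x => v (r • x)) x =
      (r * r) • fderiv ℝ (fderiv ℝ v) (r • x) := by
    have h : DifferentiableAt ℝ (fun x => fderiv ℝ v (r • x)) x :=
      (hDv.comp (contDiff_const_smul r)).contDiffAt.differentiableAt (by simp)
    rw [funext hD1]
    refine (fderiv_fun_const_smul h r).trans ?_
    rw [fderiv_comp_smul, smul_smul]
  refine ⟨fun x => v (r • x), hv.comp (contDiff_const_smul r),
    hvc.comp_homeomorph (Homeomorph.smulOfNeZero r hr0.ne'), ?_⟩
  have e1 : eLpNorm (fun x => fderiv ℝ (fderiv ℝ fun x => v (r • x)) x) q μ =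
      ENNReal.ofReal (r * r) * eLpNorm (fun x => fderiv ℝ (fderiv ℝ v) (r • x)) q μ := by
    simp_rw [hD2]
    exact eLpNorm_nonneg_const_smul μ (fun x => fderiv ℝ (fderiv ℝ v) (r • x)) q (by positivity)
  have e2 : eLpNorm (fun x : E => ‖x‖⁻¹ * ‖fderiv ℝ (fun x => v (r • x)) x‖) q μ =
      ENNReal.ofReal (r * r) *
        eLpNorm (fun x : E => ‖r • x‖⁻¹ * ‖fderiv ℝ v (r • x)‖) q μ := by
    rw [← eLpNorm_nonneg_const_smul μ _ q (by positivity : 0 ≤ r * r)]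
    congr 1
    ext x
    simp only [hD1, norm_smul, Real.norm_of_nonneg hr0.le, smul_eq_mul, mul_inv]
    field_simp
  rw [e1, e2, eLpNorm_comp_smul_addHaar μ v hqt hr0.ne',
    eLpNorm_comp_smul_addHaar μ (fderiv ℝ (fderiv ℝ v)) hqt hr0.ne',
    eLpNorm_comp_smul_addHaar μ (fun x => ‖x‖⁻¹ * ‖fderiv ℝ v x‖) hqt hr0.ne']
  set k := ENNReal.ofReal |(r ^ Module.finrank ℝ E)⁻¹| ^ (1 / q).toReal with hk
  have hk0 : k ≠ 0 := (ENNReal.rpow_pos (ofReal_pos.2 (by positivity)) ofReal_ne_top).ne'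
  have hkt : k ≠ ∞ := ENNReal.rpow_ne_top_of_nonneg toReal_nonneg ofReal_ne_top
  calc ENNReal.ofReal ε * (ENNReal.ofReal (r * r) * (k * B)) + ENNReal.ofReal C * (k * U)
      = k * (ENNReal.ofReal ε * ENNReal.ofReal (r * r) * B + ENNReal.ofReal C * U) := by ring
    _ ≤ k * (ENNReal.ofReal (r * r) * ENNReal.ofReal m) := by
        gcongr
        rw [← ofReal_toReal hB, ← ofReal_toReal hU, ← ofReal_mul (by positivity),
          ← ofReal_mul (by positivity), ← ofReal_mul (by positivity), ← ofReal_mul (by positivity),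
          ← ofReal_add (by positivity) (by positivity)]
        apply ofReal_le_ofReal
        nlinarith [mul_le_mul_of_nonneg_left hεB (by positivity : 0 ≤ r * r),
          mul_le_mul_of_nonneg_right hr1 (by positivity : 0 ≤ r * (m / 2))]
    _ < k * (ENNReal.ofReal (r * r) * a) := by
        refine ENNReal.mul_lt_mul_right hk0 hkt ?_
        exact ENNReal.mul_lt_mul_right (ofReal_pos.2 (by positivity)).ne' ofReal_ne_top hma
    _ = ENNReal.ofReal (r * r) * (k * a) := by ring

/-- For `b(x) = |x|⁻¹` and `1 < p < d`, the estimate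
`‖b|Du|‖_{L_p} ≤ ε ‖D²u‖_{L_p} + N(ε) ‖u‖_{L_p}` fails for all small `ε`: there exists
`ε₀ > 0` such that for every `C > 0` some `u ∈ C_0^∞` violates the bound. -/
theorem no_small_eps_interpolation (d : ℕ) (hd : 2 ≤ d) (p : ℝ) (hp : 1 < p) (hpd : p < d) :
    ∃ ε₀ : ℝ, 0 < ε₀ ∧
      ∀ C : ℝ, 0 < C →
        ∃ u : EuclideanSpace ℝ (Fin d) → ℝ,
          ContDiff ℝ (⊤ : ℕ∞) u ∧ HasCompactSupport u ∧
          ENNReal.ofReal ε₀ *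
              eLpNorm (fun x => fderiv ℝ (fderiv ℝ u) x) (ENNReal.ofReal p) volume +
            ENNReal.ofReal C * eLpNorm u (ENNReal.ofReal p) volume <
          eLpNorm (fun x : EuclideanSpace ℝ (Fin d) => ‖x‖⁻¹ * ‖fderiv ℝ u x‖)
            (ENNReal.ofReal p) volume := by
  have : NeZero d := ⟨by omega⟩
  exact exists_pos_forall_exists_interpolation_lt volume
    (ofReal_pos.2 (by linarith)).ne' ofReal_ne_top
end

section
/- Let d ≥ 2, γ ∈ {0,1}, p, q ∈ (1,∞), r ∈ [p,∞), and suppose κ := γ + d/p + 2/q − d/r < 2. Then there is a constant N = N(d, p, q, r, γ) such that for every u ∈ C_0^∞(ℝ^{d+1}) and every ε > 0, ‖D^γ u(0,·)‖_{L_r(ℝ^d)} ≤ N ε (‖∂_t u‖_{L_{p,q}} + ‖D²u‖_{L_{p,q}}) + N ε^{-κ/(2−κ)} ‖u‖_{L_{p,q}}. -/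
open MeasureTheory ENNReal Metric Set

/-- The mixed norm `‖g‖_{L_{p,q}}^q = ∫_ℝ (∫_{ℝ^d} |g(t,x)|^p dx)^{q/p} dt`. -/
noncomputable def mixedNorm (d : ℕ) (p q : ℝ) (g : ℝ × EuclideanSpace ℝ (Fin d) → ℝ) : ℝ≥0∞ :=
  (∫⁻ t : ℝ, (∫⁻ x : EuclideanSpace ℝ (Fin d),
    (ENNReal.ofReal |g (t, x)|) ^ p) ^ (q / p)) ^ (1 / q)

/-- The parabolic cylinder `C_ρ(t,x) = [t, t+ρ²) × B_ρ(x)`. -/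
def cyl (d : ℕ) (ρ : ℝ) (z : ℝ × EuclideanSpace ℝ (Fin d)) :
    Set (ℝ × EuclideanSpace ℝ (Fin d)) :=
  Set.Ico z.1 (z.1 + ρ ^ 2) ×ˢ ball z.2 ρ

/-- The trace `D^γ u(0,·)` : `u(0,x)` if `γ = 0` and `|Du(0,x)|` if `γ = 1`. -/
noncomputable def traceD (d : ℕ) (γ : ℕ) (u : ℝ × EuclideanSpace ℝ (Fin d) → ℝ)
    (x : EuclideanSpace ℝ (Fin d)) : ℝ :=
  if γ = 1 then ‖fderiv ℝ (fun y => u (0, y)) x‖ else u (0, x)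

/-- The time derivative `∂_t u`. -/
noncomputable def timeDeriv (d : ℕ) (u : ℝ × EuclideanSpace ℝ (Fin d) → ℝ)
    (z : ℝ × EuclideanSpace ℝ (Fin d)) : ℝ :=
  deriv (fun s => u (s, z.2)) z.1

/-- The norm of the spatial gradient `|Du|`. -/
noncomputable def spaceGradNorm (d : ℕ) (u : ℝ × EuclideanSpace ℝ (Fin d) → ℝ)
    (z : ℝ × EuclideanSpace ℝ (Fin d)) : ℝ :=
  ‖fderiv ℝ (fun y => u (z.1, y)) z.2‖

/-- The norm of the spatial Hessian `|D²u|`. -/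
noncomputable def spaceHessNorm (d : ℕ) (u : ℝ × EuclideanSpace ℝ (Fin d) → ℝ)
    (z : ℝ × EuclideanSpace ℝ (Fin d)) : ℝ :=
  ‖fderiv ℝ (fun y => fderiv ℝ (fun w => u (z.1, w)) y) z.2‖

/-- Minkowski's integral inequality for `ℝ≥0∞`-valued functions. -/
theorem lintegral_lintegral_rpow_le {α β : Type*} [MeasurableSpace α] [MeasurableSpace β]
    {μ : Measure α} {ν : Measure β} [SigmaFinite μ] [SFinite ν] {r : ℝ} (hr : 1 < r)
    {F : α → β → ℝ≥0∞} (hF : Measurable (Function.uncurry F)) :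
    (∫⁻ x, (∫⁻ t, F x t ∂ν) ^ r ∂μ) ^ (1 / r) ≤
      ∫⁻ t, (∫⁻ x, F x t ^ r ∂μ) ^ (1 / r) ∂ν := by
  have hr0 : 0 < r := by linarith
  set R := ∫⁻ t, (∫⁻ x, F x t ^ r ∂μ) ^ (1 / r) ∂ν
  set H : α → ℝ≥0∞ := fun x => ∫⁻ t, F x t ∂ν
  have hH : Measurable H := hF.lintegral_prod_right'
  let G : ℕ → α → ℝ≥0∞ := fun n => (spanningSets μ n).indicator fun x => min (H x) n
  have hG : ∀ n, Measurable (G n) := fun n =>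
    (hH.min measurable_const).indicator (measurableSet_spanningSets μ n)
  have hGH : ∀ n x, G n x ≤ H x := fun n x =>
    Set.indicator_apply_le' (fun _ => min_le_left _ _) (fun _ => zero_le)
  have hGmono : ∀ x, Monotone fun n => G n x := by
    intro x m n hmn
    dsimp only [G]
    by_cases hx : x ∈ spanningSets μ m
    · rw [indicator_of_mem hx, indicator_of_mem (monotone_spanningSets μ hmn hx)]
      gcongr
    · rw [indicator_of_notMem hx]
      exact zero_le
  have hGlim : ∀ x, Filter.Tendsto (fun n => G n x) Filter.atTop (nhds (H x)) := by
    intro x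
    have h1 : Filter.Tendsto (fun n : ℕ => min (H x) (n : ℝ≥0∞)) Filter.atTop
        (nhds (min (H x) ⊤)) :=
      tendsto_const_nhds.min ENNReal.tendsto_nat_nhds_top
    rw [min_top_right] at h1
    refine h1.congr' ?_
    filter_upwards [Filter.eventually_ge_atTop (spanningSetsIndex μ x)] with n hn
    simp only [G]
    rw [indicator_of_mem (mem_spanningSets_of_index_le μ x hn)]
  have hfin : ∀ n, ∫⁻ x, G n x ^ r ∂μ ≠ ⊤ := by
    intro n
    have : ∫⁻ x, G n x ^ r ∂μ ≤ ∫⁻ x in spanningSets μ n, (n : ℝ≥0∞) ^ r ∂μ := by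
      rw [← lintegral_indicator (measurableSet_spanningSets μ n)]
      refine lintegral_mono fun x => ?_
      by_cases hx : x ∈ spanningSets μ n
      · simp only [G, indicator_of_mem hx]
        gcongr
        exact min_le_right _ _
      · simp [G, indicator_of_notMem hx, hr0]
    refine ne_top_of_le_ne_top ?_ this
    rw [setLIntegral_const]
    exact ENNReal.mul_ne_top (ENNReal.rpow_ne_top_of_nonneg hr0.le (natCast_ne_top n))
      (measure_spanningSets_lt_top μ n).ne
  have hconj : r.HolderConjugate (Real.conjExponent r) := Real.HolderConjugate.conjExponent hr
  have key : ∀ n, ∫⁻ x, G n x ^ r ∂μ ≤ R ^ r := by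
    intro n
    set I := ∫⁻ x, G n x ^ r ∂μ with hI
    have h1 : I ≤ R * I ^ (1 / Real.conjExponent r) := by
      calc I ≤ ∫⁻ x, H x * G n x ^ (r - 1) ∂μ := by
            refine lintegral_mono fun x => ?_
            have : G n x ^ r = G n x * G n x ^ (r - 1) := by
              nth_rw 2 [← ENNReal.rpow_one (G n x)]
              rw [← ENNReal.rpow_add_of_nonneg _ _ zero_le_one (by linarith)]
              congr 1; ring
            rw [this]
            gcongr
            exact hGH n x
        _ = ∫⁻ x, ∫⁻ t, F x t * G n x ^ (r - 1) ∂ν ∂μ := by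
            refine lintegral_congr fun x => ?_
            exact (lintegral_mul_const _ hF.of_uncurry_left).symm
        _ = ∫⁻ t, ∫⁻ x, F x t * G n x ^ (r - 1) ∂μ ∂ν := by
            apply lintegral_lintegral_swap
            apply Measurable.aemeasurable
            exact hF.mul (((hG n).comp measurable_fst).pow_const _)
        _ ≤ ∫⁻ t, (∫⁻ x, F x t ^ r ∂μ) ^ (1 / r) * I ^ (1 / Real.conjExponent r) ∂ν := by
            refine lintegral_mono fun t => ?_
            exact ENNReal.lintegral_mul_rpow_le_lintegral_rpow_mul_lintegral_rpow hconj
              hF.of_uncurry_right.aemeasurable (hG n).aemeasurable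
        _ = R * I ^ (1 / Real.conjExponent r) := by
            refine lintegral_mul_const _ ?_
            exact (Measurable.lintegral_prod_left' (hF.pow_const r)).pow_const _
    rcases eq_or_ne I 0 with h0 | h0
    · rw [h0]; exact zero_le
    have h2 : I ^ (1 / r) * I ^ (1 / Real.conjExponent r) = I := by
      rw [← ENNReal.rpow_add _ _ h0 (hfin n), one_div, one_div, hconj.inv_add_inv_eq_one,
        ENNReal.rpow_one]
    replace h1 := h2.trans_le h1
    have h3 : I ^ (1 / r) ≤ R := by
      refine (ENNReal.mul_le_mul_iff_left ?_ ?_).1 h1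
      · exact (ENNReal.rpow_pos (pos_iff_ne_zero.2 h0) (hfin n)).ne'
      · exact ENNReal.rpow_ne_top_of_nonneg (by have := hconj.symm.pos; positivity) (hfin n)
    rwa [one_div, ENNReal.rpow_inv_le_iff hr0] at h3
  rw [one_div, ENNReal.rpow_inv_le_iff hr0]
  refine le_of_tendsto' (lintegral_tendsto_of_tendsto_of_monotone
    (fun n => ((hG n).pow_const r).aemeasurable) ?_ ?_) key
  · exact Filter.Eventually.of_forall fun x m n hmn => by
      dsimp only
      gcongr
      exact hGmono x hmn
  · exact Filter.Eventually.of_forall fun x =>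
      (ENNReal.continuous_rpow_const.tendsto _).comp (hGlim x)

/-- The change of variables `y = x - s z` in a Lebesgue integral. -/
theorem lintegral_sub_smul (d : ℕ) {f : EuclideanSpace ℝ (Fin d) → ℝ≥0∞} (hf : Measurable f)
    {s : ℝ} (hs : 0 < s) (x : EuclideanSpace ℝ (Fin d)) :
    ∫⁻ z, f (x - s • z) = ENNReal.ofReal (s ^ (-(d : ℝ))) * ∫⁻ y, f y := by
  have h1 : ∫⁻ z, f (x - s • z) = ∫⁻ y, f (x - y) ∂(Measure.map (s • ·) volume) :=
    (lintegral_map (hf.comp (measurable_const.sub measurable_id))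
      (measurable_const_smul s)).symm
  rw [h1, Measure.map_addHaar_smul _ hs.ne', lintegral_smul_measure, smul_eq_mul,
    lintegral_sub_left_eq_self f x]
  congr 2
  rw [finrank_euclideanSpace_fin, abs_of_pos (by positivity), Real.rpow_neg hs.le,
    Real.rpow_natCast]

/-- Young's convolution inequality, for the convolution with a kernel dilated by `s`. -/
theorem lintegral_conv_smul_rpow_le (d : ℕ) {p r m : ℝ} (hp : 1 < p) (hr : p ≤ r)
    (hm : m⁻¹ = 1 + r⁻¹ - p⁻¹) {f k : EuclideanSpace ℝ (Fin d) → ℝ≥0∞} (hf : Measurable f)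
    (hk : Measurable k) {s : ℝ} (hs : 0 < s) :
    (∫⁻ x, (∫⁻ z, f (x - s • z) * k z) ^ r) ^ (1 / r) ≤
      (∫⁻ z, k z ^ m) ^ (1 / m) * ENNReal.ofReal (s ^ (-(d * (p⁻¹ - r⁻¹)))) *
        (∫⁻ y, f y ^ p) ^ (1 / p) := by
  have hp0 : 0 < p := by linarith
  have hr0 : 0 < r := by linarith
  have hpr : 0 ≤ p⁻¹ - r⁻¹ := sub_nonneg.2 (inv_anti₀ hp0 hr)
  have hp1 : 0 < 1 - p⁻¹ := sub_pos.2 (inv_lt_one_of_one_lt₀ hp)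
  have hr1 : 0 < r⁻¹ := inv_pos.2 hr0
  have hm0 : 0 < m := inv_pos.1 (by rw [hm]; linarith)
  set K := ∫⁻ z, k z ^ m
  set A := ∫⁻ y, f y ^ p
  have hfm : ∀ x, Measurable fun z => f (x - s • z) := fun x =>
    hf.comp (measurable_const.sub (measurable_const_smul s))
  have hpt : ∀ x, ∫⁻ z, f (x - s • z) * k z ≤
      (∫⁻ z, f (x - s • z) ^ p * k z ^ m) ^ r⁻¹ *
        ((ENNReal.ofReal (s ^ (-(d : ℝ))) * A) ^ (p⁻¹ - r⁻¹) * K ^ (1 - p⁻¹)) := by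
    intro x
    have h := ENNReal.lintegral_prod_norm_pow_le (μ := volume) (Finset.univ : Finset (Fin 3))
      (f := ![fun z => f (x - s • z) ^ p * k z ^ m, fun z => f (x - s • z) ^ p,
        fun z => k z ^ m]) (p := ![r⁻¹, p⁻¹ - r⁻¹, 1 - p⁻¹])
      (by
        intro i _
        fin_cases i
        · exact (((hfm x).pow_const p).mul (hk.pow_const m)).aemeasurable
        · exact ((hfm x).pow_const p).aemeasurable
        · exact (hk.pow_const m).aemeasurable)
      (by simp [Fin.sum_univ_three])
      (by
        intro i _
        fin_cases i
        · exact hr1.le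
        · exact hpr
        · exact hp1.le)
    simp only [Fin.prod_univ_three, Matrix.cons_val_zero, Matrix.cons_val_one,
      Matrix.cons_val] at h
    rw [lintegral_sub_smul d (hf.pow_const p) hs x, mul_assoc] at h
    refine le_trans (lintegral_mono fun z => le_of_eq ?_) h
    rw [ENNReal.mul_rpow_of_nonneg _ _ hr1.le, ← ENNReal.rpow_mul, ← ENNReal.rpow_mul,
      ← ENNReal.rpow_mul, ← ENNReal.rpow_mul,
      mul_right_comm (f (x - s • z) ^ (p * r⁻¹)),
      ← ENNReal.rpow_add_of_nonneg _ _ (by positivity) (by positivity), mul_assoc,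
      ← ENNReal.rpow_add_of_nonneg _ _ (by positivity) (by positivity),
      show p * r⁻¹ + p * (p⁻¹ - r⁻¹) = 1 by field_simp; ring,
      show m * r⁻¹ + m * (1 - p⁻¹) = m * m⁻¹ by rw [hm]; ring, mul_inv_cancel₀ hm0.ne',
      ENNReal.rpow_one, ENNReal.rpow_one]
  set B := (ENNReal.ofReal (s ^ (-(d : ℝ))) * A) ^ (p⁻¹ - r⁻¹) * K ^ (1 - p⁻¹)
  have hmeas : Measurable fun y : EuclideanSpace ℝ (Fin d) × EuclideanSpace ℝ (Fin d) =>
      f (y.1 - s • y.2) ^ p * k y.2 ^ m :=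
    ((hf.comp (measurable_fst.sub (measurable_snd.const_smul s))).pow_const p).mul
      ((hk.comp measurable_snd).pow_const m)
  have hint : ∫⁻ x, ∫⁻ z, f (x - s • z) ^ p * k z ^ m = A * K := by
    rw [lintegral_lintegral_swap hmeas.aemeasurable]
    have : ∀ z, ∫⁻ x, f (x - s • z) ^ p * k z ^ m = A * k z ^ m := by
      intro z
      refine (lintegral_mul_const (k z ^ m)
        ((hf.comp (measurable_sub_const (s • z))).pow_const p)).trans ?_
      congr 1
      exact lintegral_sub_right_eq_self (fun y => f y ^ p) (s • z)
    simp_rw [this]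
    exact lintegral_const_mul _ (hk.pow_const m)
  calc (∫⁻ x, (∫⁻ z, f (x - s • z) * k z) ^ r) ^ (1 / r)
      ≤ (∫⁻ x, ((∫⁻ z, f (x - s • z) ^ p * k z ^ m) ^ r⁻¹ * B) ^ r) ^ (1 / r) := by
        gcongr with x
        exact hpt x
    _ = (A * K) ^ r⁻¹ * B := by
        have : ∀ x, ((∫⁻ z, f (x - s • z) ^ p * k z ^ m) ^ r⁻¹ * B) ^ r =
            (∫⁻ z, f (x - s • z) ^ p * k z ^ m) * B ^ r := by
          intro x
          rw [ENNReal.mul_rpow_of_nonneg _ _ hr0.le, ENNReal.rpow_inv_rpow hr0.ne']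
        simp_rw [this]
        rw [lintegral_mul_const _ hmeas.lintegral_prod_right', hint, one_div,
          ENNReal.mul_rpow_of_nonneg _ _ hr1.le, ENNReal.rpow_rpow_inv hr0.ne']
    _ = K ^ (1 / m) * ENNReal.ofReal (s ^ (-(d * (p⁻¹ - r⁻¹)))) * A ^ (1 / p) := by
        have e1 : ENNReal.ofReal (s ^ (-(d * (p⁻¹ - r⁻¹)))) =
            ENNReal.ofReal (s ^ (-(d : ℝ))) ^ (p⁻¹ - r⁻¹) := by
          rw [ENNReal.ofReal_rpow_of_nonneg (by positivity) hpr, ← Real.rpow_mul hs.le]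
          congr 2; ring
        have e2 : K ^ (1 / m) = K ^ r⁻¹ * K ^ (1 - p⁻¹) := by
          rw [← ENNReal.rpow_add_of_nonneg _ _ hr1.le hp1.le, one_div, hm]
          congr 1; ring
        have e3 : A ^ (1 / p) = A ^ r⁻¹ * A ^ (p⁻¹ - r⁻¹) := by
          rw [← ENNReal.rpow_add_of_nonneg _ _ hr1.le hpr, one_div]
          congr 1; ring
        simp only [B]
        rw [e1, e2, e3, ENNReal.mul_rpow_of_nonneg _ _ hr1.le, ENNReal.mul_rpow_of_nonneg _ _ hpr]
        ring

/-- The mixed norm of an `ℝ≥0∞`-valued function. -/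
noncomputable def lmixedNorm (d : ℕ) (p q : ℝ)
    (g : ℝ × EuclideanSpace ℝ (Fin d) → ℝ≥0∞) : ℝ≥0∞ :=
  (∫⁻ t : ℝ, (∫⁻ x : EuclideanSpace ℝ (Fin d), g (t, x) ^ p) ^ (q / p)) ^ (1 / q)

/-- The Gaussian kernel `exp (-|z|² / 4)`. -/
noncomputable def gaussKernel (d : ℕ) (z : EuclideanSpace ℝ (Fin d)) : ℝ≥0∞ :=
  ENNReal.ofReal (Real.exp (-(1 / 4) * ‖z‖ ^ 2))

theorem measurable_gaussKernel (d : ℕ) : Measurable (gaussKernel d) := by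
  unfold gaussKernel
  fun_prop

theorem integrable_exp_neg_mul_norm_sq (d : ℕ) {b : ℝ} (hb : 0 < b) :
    Integrable fun z : EuclideanSpace ℝ (Fin d) => Real.exp (-b * ‖z‖ ^ 2) := by
  have h := (GaussianFourier.integrable_cexp_neg_mul_sq_norm_add (V := EuclideanSpace ℝ (Fin d))
    (b := (b : ℂ)) (by simpa using hb) 0 0).re
  refine h.congr (Filter.Eventually.of_forall fun z => ?_)
  simp only [zero_mul, add_zero]
  rw [show -(b : ℂ) * (‖z‖ : ℂ) ^ 2 = ((-b * ‖z‖ ^ 2 : ℝ) : ℂ) by push_cast; ring]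
  exact Complex.exp_ofReal_re _

theorem lintegral_gaussKernel_rpow_ne_top (d : ℕ) {m : ℝ} (hm : 0 < m) :
    ∫⁻ z, gaussKernel d z ^ m ≠ ⊤ := by
  have h := (integrable_exp_neg_mul_norm_sq d (b := m / 4) (by positivity)).lintegral_lt_top.ne
  convert h using 3 with z
  rw [gaussKernel, ENNReal.ofReal_rpow_of_nonneg (by positivity) hm.le, ← Real.exp_mul]
  congr 2; ring

/-- The Gaussian potential `∫_0^T t^{-γ/2} ∫ g(t, x - √t z) exp (-|z|²/4) dz dt`. -/
noncomputable def heatPotential (d : ℕ) (γ : ℕ) (T : ℝ)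
    (g : ℝ × EuclideanSpace ℝ (Fin d) → ℝ≥0∞) (x : EuclideanSpace ℝ (Fin d)) : ℝ≥0∞ :=
  ∫⁻ t in Ioo 0 T, ENNReal.ofReal (t ^ (-(γ / 2 : ℝ))) *
    ∫⁻ z, g (t, x - √t • z) * gaussKernel d z

theorem measurable_heatPotential_inner (d : ℕ) (γ : ℕ)
    {g : ℝ × EuclideanSpace ℝ (Fin d) → ℝ≥0∞} (hg : Measurable g) :
    Measurable fun y : EuclideanSpace ℝ (Fin d) × ℝ => ENNReal.ofReal (y.2 ^ (-(γ / 2 : ℝ))) *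
      ∫⁻ z, g (y.2, y.1 - √y.2 • z) * gaussKernel d z := by
  refine (measurable_snd.pow_const _).ennreal_ofReal.mul ?_
  refine Measurable.lintegral_prod_right' (f := fun w : (EuclideanSpace ℝ (Fin d) × ℝ) ×
    EuclideanSpace ℝ (Fin d) => g (w.1.2, w.1.1 - √w.1.2 • w.2) * gaussKernel d w.2) ?_
  have : Measurable fun w : (EuclideanSpace ℝ (Fin d) × ℝ) × EuclideanSpace ℝ (Fin d) =>
    (w.1.2, w.1.1 - √w.1.2 • w.2) := by fun_prop
  exact (hg.comp this).mul ((measurable_gaussKernel d).comp measurable_snd)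

theorem measurable_heatPotential (d : ℕ) (γ : ℕ) (T : ℝ)
    {g : ℝ × EuclideanSpace ℝ (Fin d) → ℝ≥0∞} (hg : Measurable g) :
    Measurable (heatPotential d γ T g) :=
  (measurable_heatPotential_inner d γ hg).lintegral_prod_right'

theorem lintegral_Ioo_rpow {b T : ℝ} (hb : -1 < b) (hT : 0 < T) :
    ∫⁻ t in Ioo 0 T, ENNReal.ofReal (t ^ b) = ENNReal.ofReal (T ^ (b + 1) / (b + 1)) := by
  have hi : IntegrableOn (fun t : ℝ => t ^ b) (Ioo 0 T) := by
    have := intervalIntegral.intervalIntegrable_rpow' (a := 0) (b := T) hb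
    rw [intervalIntegrable_iff_integrableOn_Ioo_of_le hT.le] at this
    exact this
  rw [← ofReal_integral_eq_lintegral_ofReal hi]
  · rw [← integral_Ioc_eq_integral_Ioo, ← intervalIntegral.integral_of_le hT.le,
      integral_rpow (Or.inl hb), Real.zero_rpow (by linarith), sub_zero]
  · filter_upwards [self_mem_ae_restrict measurableSet_Ioo] with t ht
    exact Real.rpow_nonneg ht.1.le _

/-- Smoothing of the Gaussian potential from `L_{p,q}` to `L_r`. -/
theorem exists_heatPotential_le (d : ℕ) (γ : ℕ) {p q r κ : ℝ} (hp : 1 < p) (hq : 1 < q)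
    (hr : p ≤ r) (hκdef : κ = γ + d / p + 2 / q - d / r) (hκ : κ < 2) :
    ∃ C : ℝ, 0 ≤ C ∧ ∀ (T : ℝ) (_ : 0 < T) (g : ℝ × EuclideanSpace ℝ (Fin d) → ℝ≥0∞)
      (_ : Measurable g),
      (∫⁻ x, heatPotential d γ T g x ^ r) ^ (1 / r) ≤
        ENNReal.ofReal (C * T ^ (1 - κ / 2)) * lmixedNorm d p q g := by
  have hp0 : 0 < p := by linarith
  have hr0 : 0 < r := by linarith
  have hq0 : 0 < q := by linarith
  have hp1 : 0 < 1 - p⁻¹ := sub_pos.2 (inv_lt_one_of_one_lt₀ hp)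
  have hr1 : 0 < r⁻¹ := inv_pos.2 hr0
  obtain ⟨m, hm⟩ : ∃ m : ℝ, m⁻¹ = 1 + r⁻¹ - p⁻¹ := ⟨(1 + r⁻¹ - p⁻¹)⁻¹, inv_inv _⟩
  have hm0 : 0 < m := inv_pos.1 (by rw [hm]; linarith)
  set K := (∫⁻ z, gaussKernel d z ^ m) ^ (1 / m)
  have hK : K ≠ ⊤ := ENNReal.rpow_ne_top_of_nonneg (by positivity)
    (lintegral_gaussKernel_rpow_ne_top d hm0)
  have hconj : q.HolderConjugate (Real.conjExponent q) := Real.HolderConjugate.conjExponent hq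
  set q' := Real.conjExponent q
  have hq' : 0 < q' := hconj.symm.pos
  have hqq : q⁻¹ + q'⁻¹ = 1 := hconj.inv_add_inv_eq_one
  set a : ℝ := γ / 2 + d * (p⁻¹ - r⁻¹) / 2
  have ha : a = κ / 2 - q⁻¹ := by
    simp only [a, hκdef, div_eq_mul_inv]; ring
  have haq : a * q' < 1 := by
    have : a < q'⁻¹ := by rw [ha]; linarith
    calc a * q' < q'⁻¹ * q' := by gcongr
      _ = 1 := inv_mul_cancel₀ hq'.ne'
  have hb : -1 < -a * q' := by linarith
  refine ⟨K.toReal * (-a * q' + 1)⁻¹ ^ (1 / q'), by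
    have : 0 < -a * q' + 1 := by linarith
    positivity, fun T hT g hg => ?_⟩
  have hgt : ∀ t, Measurable fun x => g (t, x) := fun t => hg.comp measurable_prodMk_left
  have hhm : Measurable fun t => (∫⁻ x, g (t, x) ^ p) ^ (1 / p) :=
    (Measurable.lintegral_prod_right' (hg.pow_const p)).pow_const _
  calc (∫⁻ x, heatPotential d γ T g x ^ r) ^ (1 / r)
      ≤ ∫⁻ t in Ioo 0 T, (∫⁻ x, (ENNReal.ofReal (t ^ (-(γ / 2 : ℝ))) *
          ∫⁻ z, g (t, x - √t • z) * gaussKernel d z) ^ r) ^ (1 / r) :=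
        lintegral_lintegral_rpow_le (by linarith) (measurable_heatPotential_inner d γ hg)
    _ ≤ ∫⁻ t in Ioo 0 T, K * (ENNReal.ofReal (t ^ (-a)) * (∫⁻ x, g (t, x) ^ p) ^ (1 / p)) := by
        refine setLIntegral_mono' measurableSet_Ioo fun t ht => ?_
        have ht0 : 0 < t := ht.1
        have hY := lintegral_conv_smul_rpow_le d hp hr hm (hgt t) (measurable_gaussKernel d)
          (Real.sqrt_pos.2 ht0)
        have hmeas : Measurable fun x => ∫⁻ z, g (t, x - √t • z) * gaussKernel d z := by
          refine Measurable.lintegral_prod_right' (f := fun w : EuclideanSpace ℝ (Fin d) ×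
            EuclideanSpace ℝ (Fin d) => g (t, w.1 - √t • w.2) * gaussKernel d w.2) ?_
          have : Measurable fun w : EuclideanSpace ℝ (Fin d) × EuclideanSpace ℝ (Fin d) =>
            (t, w.1 - √t • w.2) := by fun_prop
          exact (hg.comp this).mul ((measurable_gaussKernel d).comp measurable_snd)
        simp_rw [ENNReal.mul_rpow_of_nonneg _ _ hr0.le]
        rw [lintegral_const_mul _ (hmeas.pow_const r),
          ENNReal.mul_rpow_of_nonneg _ _ (by positivity), one_div, ENNReal.rpow_rpow_inv hr0.ne',
          ← one_div]
        refine (mul_le_mul_right hY _).trans_eq ?_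
        have e : ENNReal.ofReal (t ^ (-a)) = ENNReal.ofReal (t ^ (-(γ / 2 : ℝ))) *
            ENNReal.ofReal (√t ^ (-(d * (p⁻¹ - r⁻¹)))) := by
          rw [← ENNReal.ofReal_mul (by positivity), Real.sqrt_eq_rpow, ← Real.rpow_mul ht0.le,
            ← Real.rpow_add ht0]
          congr 2; simp only [a]; ring
        rw [e]
        ring
    _ = K * ∫⁻ t in Ioo 0 T, ENNReal.ofReal (t ^ (-a)) * (∫⁻ x, g (t, x) ^ p) ^ (1 / p) := by
        rw [lintegral_const_mul]
        exact (measurable_id.pow_const _).ennreal_ofReal.mul hhm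
    _ ≤ K * ((∫⁻ t in Ioo 0 T, ENNReal.ofReal (t ^ (-a)) ^ q') ^ (1 / q') *
          (∫⁻ t in Ioo 0 T, ((∫⁻ x, g (t, x) ^ p) ^ (1 / p)) ^ q) ^ (1 / q)) := by
        gcongr
        exact ENNReal.lintegral_mul_le_Lp_mul_Lq _ hconj.symm
          (measurable_id.pow_const _).ennreal_ofReal.aemeasurable hhm.aemeasurable
    _ ≤ ENNReal.ofReal (K.toReal * (-a * q' + 1)⁻¹ ^ (1 / q') * T ^ (1 - κ / 2)) *
          lmixedNorm d p q g := by
        rw [← mul_assoc]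
        gcongr ?_ * ?_
        · have h1 : ∫⁻ t in Ioo 0 T, ENNReal.ofReal (t ^ (-a)) ^ q' =
              ENNReal.ofReal (T ^ (-a * q' + 1) / (-a * q' + 1)) := by
            rw [← lintegral_Ioo_rpow hb hT]
            refine setLIntegral_congr_fun measurableSet_Ioo fun t ht => ?_
            rw [ENNReal.ofReal_rpow_of_nonneg (Real.rpow_nonneg ht.1.le _) hq'.le,
              ← Real.rpow_mul ht.1.le]
          have h2 : 0 < -a * q' + 1 := by linarith
          rw [h1, ENNReal.ofReal_rpow_of_nonneg (by positivity) (by positivity),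
            ← ENNReal.ofReal_toReal hK, ← ENNReal.ofReal_mul ENNReal.toReal_nonneg,
            ENNReal.toReal_ofReal ENNReal.toReal_nonneg, div_eq_mul_inv,
            Real.mul_rpow (by positivity) (by positivity), ← Real.rpow_mul hT.le,
            show (-a * q' + 1) * (1 / q') = 1 - κ / 2 by
              have : q'⁻¹ = 1 - q⁻¹ := by linarith
              rw [one_div, add_mul, mul_assoc, mul_inv_cancel₀ hq'.ne', one_mul, this, ha]
              ring]
          apply le_of_eq
          congr 1
          ring
        · rw [lmixedNorm]
          refine ENNReal.rpow_le_rpow ?_ (by positivity)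
          refine (setLIntegral_le_lintegral _ _).trans_eq (lintegral_congr fun t => ?_)
          rw [← ENNReal.rpow_mul]
          congr 1; ring

/-- A smooth compactly supported function on space-time. -/
def IsTestFun (d : ℕ) (f : ℝ × EuclideanSpace ℝ (Fin d) → ℝ) : Prop :=
  ContDiff ℝ (⊤ : ℕ∞) f ∧ HasCompactSupport f

/-- The derivative of `f` in the space-time direction `w`. -/
noncomputable def dirDeriv (d : ℕ) (w : ℝ × EuclideanSpace ℝ (Fin d))
    (f : ℝ × EuclideanSpace ℝ (Fin d) → ℝ) (z : ℝ × EuclideanSpace ℝ (Fin d)) : ℝ :=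
  fderiv ℝ f z w

/-- The half Laplacian `½ ∑ᵢ ∂ᵢ∂ᵢ f` in the space variables. -/
noncomputable def halfLaplacian (d : ℕ) (f : ℝ × EuclideanSpace ℝ (Fin d) → ℝ)
    (z : ℝ × EuclideanSpace ℝ (Fin d)) : ℝ :=
  ∑ i : Fin d, 1 / 2 * dirDeriv d (0, EuclideanSpace.single i 1)
    (dirDeriv d (0, EuclideanSpace.single i 1) f) z

/-- The backward heat operator `∂ₜ f + ½ Δ f`. -/
noncomputable def backwardHeat (d : ℕ) (f : ℝ × EuclideanSpace ℝ (Fin d) → ℝ)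
    (z : ℝ × EuclideanSpace ℝ (Fin d)) : ℝ :=
  dirDeriv d (1, 0) f z + halfLaplacian d f z

namespace IsTestFun

variable {d : ℕ} {f g : ℝ × EuclideanSpace ℝ (Fin d) → ℝ}

theorem continuous (hf : IsTestFun d f) : Continuous f := hf.1.continuous

theorem differentiable (hf : IsTestFun d f) : Differentiable ℝ f :=
  hf.1.differentiable (by simp)

theorem exists_bound (hf : IsTestFun d f) : ∃ M, ∀ z, |f z| ≤ M :=
  hf.2.exists_bound_of_continuous hf.continuous

theorem exists_bound_fderiv (hf : IsTestFun d f) : ∃ M, 0 ≤ M ∧ ∀ z, ‖fderiv ℝ f z‖ ≤ M := by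
  obtain ⟨M, hM⟩ := (hf.2.fderiv ℝ).exists_bound_of_continuous (hf.1.continuous_fderiv (by simp))
  exact ⟨M, (norm_nonneg _).trans (hM 0), hM⟩

theorem dirDeriv (hf : IsTestFun d f) (w : ℝ × EuclideanSpace ℝ (Fin d)) :
    IsTestFun d (dirDeriv d w f) :=
  ⟨(hf.1.fderiv_right (m := (⊤ : ℕ∞)) (by simp)).clm_apply contDiff_const,
    hf.2.fderiv_apply ℝ w⟩

theorem add (hf : IsTestFun d f) (hg : IsTestFun d g) : IsTestFun d fun z => f z + g z :=
  ⟨hf.1.add hg.1, hf.2.add hg.2⟩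

theorem const_mul (hf : IsTestFun d f) (c : ℝ) : IsTestFun d fun z => c * f z :=
  ⟨contDiff_const.mul hf.1, hf.2.mul_left⟩

theorem sum {ι : Type*} (s : Finset ι) {F : ι → ℝ × EuclideanSpace ℝ (Fin d) → ℝ}
    (hF : ∀ i, IsTestFun d (F i)) : IsTestFun d fun z => ∑ i ∈ s, F i z := by
  classical
  induction s using Finset.induction with
  | empty => exact ⟨by simpa using contDiff_const, by
    simp only [Finset.sum_empty]
    exact HasCompactSupport.zero⟩
  | insert i s hi ih =>
    simp_rw [Finset.sum_insert hi]
    exact (hF i).add ih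

theorem halfLaplacian (hf : IsTestFun d f) : IsTestFun d (halfLaplacian d f) :=
  sum _ fun _ => ((hf.dirDeriv _).dirDeriv _).const_mul _

theorem backwardHeat (hf : IsTestFun d f) : IsTestFun d (backwardHeat d f) :=
  (hf.dirDeriv _).add hf.halfLaplacian

theorem dirDeriv_comm (hf : IsTestFun d f) (v w : ℝ × EuclideanSpace ℝ (Fin d)) :
    _root_.dirDeriv d v (_root_.dirDeriv d w f) = _root_.dirDeriv d w (_root_.dirDeriv d v f) := by
  have hd : Differentiable ℝ (fderiv ℝ f) :=
    (hf.1.fderiv_right (m := (⊤ : ℕ∞)) (by simp)).differentiable (by simp)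
  have h : ∀ a b z, _root_.dirDeriv d a (_root_.dirDeriv d b f) z = fderiv ℝ (fderiv ℝ f) z a b := by
    intro a b z
    have := ((hd z).hasFDerivAt.clm_apply (hasFDerivAt_const b z)).fderiv
    change fderiv ℝ (fun y => fderiv ℝ f y b) z a = _
    rw [this]
    simp
  funext z
  rw [h, h]
  exact (hf.1.contDiffAt.isSymmSndFDerivAt
    (by rw [minSmoothness_of_isRCLikeNormedField]; exact WithTop.coe_le_coe.2 (le_top : (2 : ℕ∞) ≤ ⊤))).eq v w

theorem backwardHeat_dirDeriv (hf : IsTestFun d f) (w : ℝ × EuclideanSpace ℝ (Fin d)) :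
    _root_.backwardHeat d (_root_.dirDeriv d w f) =
      _root_.dirDeriv d w (_root_.backwardHeat d f) := by
  funext z
  have h1 : _root_.dirDeriv d w (_root_.backwardHeat d f) z =
      _root_.dirDeriv d w (_root_.dirDeriv d (1, 0) f) z +
        ∑ i : Fin d, 1 / 2 * _root_.dirDeriv d w (_root_.dirDeriv d
          (0, EuclideanSpace.single i 1)
          (_root_.dirDeriv d (0, EuclideanSpace.single i 1) f)) z := by
    have hs : ∀ i : Fin d, HasFDerivAt (fun y => 1 / 2 * _root_.dirDeriv d
        (0, EuclideanSpace.single i 1) (_root_.dirDeriv d (0, EuclideanSpace.single i 1) f) y)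
        _ z := fun i =>
      (((hf.dirDeriv _).dirDeriv _).differentiable z).hasFDerivAt.const_mul (1 / 2)
    have := (((hf.dirDeriv (1, 0)).differentiable z).hasFDerivAt.add
      (HasFDerivAt.fun_sum (u := Finset.univ) fun i _ => hs i)).fderiv
    have e : _root_.dirDeriv d w (_root_.backwardHeat d f) z = _ := congrArg (fun L => L w) this
    rw [e]
    simp [_root_.dirDeriv]
  rw [h1, _root_.backwardHeat, _root_.halfLaplacian, hf.dirDeriv_comm (1, 0) w]
  congr 1
  refine Finset.sum_congr rfl fun i _ => ?_
  rw [hf.dirDeriv_comm _ w, (hf.dirDeriv _).dirDeriv_comm _ w]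

end IsTestFun

/-- The Gaussian average `∫ f(s², x - s z) exp (-|z|²/2) dz`. -/
noncomputable def gaussAvg (d : ℕ) (f : ℝ × EuclideanSpace ℝ (Fin d) → ℝ) (s : ℝ)
    (x : EuclideanSpace ℝ (Fin d)) : ℝ :=
  ∫ z, f (s ^ 2, x - s • z) * Real.exp (-(1 / 2) * ‖z‖ ^ 2)

theorem norm_mul_exp_le {d : ℕ} (z : EuclideanSpace ℝ (Fin d)) :
    ‖z‖ * Real.exp (-(1 / 2) * ‖z‖ ^ 2) ≤ Real.exp (-(1 / 4) * ‖z‖ ^ 2) := by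
  have h1 : ‖z‖ ≤ Real.exp (1 / 4 * ‖z‖ ^ 2) := by
    have := Real.add_one_le_exp (1 / 4 * ‖z‖ ^ 2)
    nlinarith [sq_nonneg (‖z‖ - 2)]
  calc ‖z‖ * Real.exp (-(1 / 2) * ‖z‖ ^ 2)
      ≤ Real.exp (1 / 4 * ‖z‖ ^ 2) * Real.exp (-(1 / 2) * ‖z‖ ^ 2) := by gcongr
    _ = _ := by rw [← Real.exp_add]; congr 1; ring

theorem exp_half_le {d : ℕ} (z : EuclideanSpace ℝ (Fin d)) :
    Real.exp (-(1 / 2) * ‖z‖ ^ 2) ≤ Real.exp (-(1 / 4) * ‖z‖ ^ 2) := by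
  gcongr
  norm_num

theorem hasFDerivAt_gaussian {d : ℕ} (z : EuclideanSpace ℝ (Fin d)) :
    HasFDerivAt (fun y : EuclideanSpace ℝ (Fin d) => Real.exp (-(1 / 2) * ‖y‖ ^ 2))
      (-(Real.exp (-(1 / 2) * ‖z‖ ^ 2)) • innerSL ℝ z) z := by
  have h := ((hasStrictFDerivAt_norm_sq z).hasFDerivAt.const_mul (-(1 / 2) : ℝ)).exp
  refine h.congr_fderiv ?_
  ext y
  simp

section Avg

variable {d : ℕ} {f : ℝ × EuclideanSpace ℝ (Fin d) → ℝ}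

/-- Gaussian integration by parts. -/
theorem smul_gaussAvg_dirDeriv (hf : IsTestFun d f) {s : ℝ} (hs : s ≠ 0)
    (x e : EuclideanSpace ℝ (Fin d)) :
    s * gaussAvg d (dirDeriv d (0, e) f) s x =
      -∫ z, f (s ^ 2, x - s • z) * (inner ℝ z e * Real.exp (-(1 / 2) * ‖z‖ ^ 2)) := by
  have hφ : ∀ z, HasFDerivAt (fun y => f (s ^ 2, x - s • y))
      ((fderiv ℝ f (s ^ 2, x - s • z)).comp (ContinuousLinearMap.prod 0
        (-(s • ContinuousLinearMap.id ℝ (EuclideanSpace ℝ (Fin d)))))) z := by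
    intro z
    exact (hf.differentiable _).hasFDerivAt.comp z
      ((hasFDerivAt_const _ z).prodMk (((hasFDerivAt_id z).const_smul s).const_sub x))
  have hcs : HasCompactSupport fun z => f (s ^ 2, x - s • z) := by
    have h1 : HasCompactSupport fun y => f (s ^ 2, y) :=
      HasCompactSupport.intro (hf.2.isCompact.image continuous_snd) fun y hy =>
        image_eq_zero_of_notMem_tsupport fun h => hy ⟨_, h, rfl⟩
    have h2 : HasCompactSupport fun z => f (s ^ 2, x - z) :=
      h1.comp_homeomorph (Homeomorph.subLeft x)
    exact h2.comp_smul hs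
  have hcφ : Continuous fun z => f (s ^ 2, x - s • z) := hf.continuous.comp (by fun_prop)
  have hd : ∀ z, fderiv ℝ (fun y => f (s ^ 2, x - s • y)) z e =
      -(s * dirDeriv d (0, e) f (s ^ 2, x - s • z)) := by
    intro z
    rw [(hφ z).fderiv]
    have h := (fderiv ℝ f (s ^ 2, x - s • z)).map_smul (-s) ((0 : ℝ), e)
    simpa [dirDeriv] using h
  have hg : ∀ z : EuclideanSpace ℝ (Fin d),
      fderiv ℝ (fun y => Real.exp (-(1 / 2) * ‖y‖ ^ 2)) z e =
      -(inner ℝ z e * Real.exp (-(1 / 2) * ‖z‖ ^ 2)) := by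
    intro z
    rw [(hasFDerivAt_gaussian z).fderiv]
    simp
    ring
  have hDc : Continuous (dirDeriv d (0, e) f) := (hf.dirDeriv _).continuous
  have h := integral_mul_fderiv_eq_neg_fderiv_mul_of_integrable (μ := volume) (v := e)
    (f := fun z => f (s ^ 2, x - s • z)) (g := fun z => Real.exp (-(1 / 2) * ‖z‖ ^ 2))
    (by
      refine Continuous.integrable_of_hasCompactSupport ?_ (hcs.fderiv_apply ℝ e).mul_right
      simp_rw [hd]
      exact ((hDc.comp (by fun_prop)).const_mul s).neg.mul (by fun_prop))
    (by
      refine Continuous.integrable_of_hasCompactSupport ?_ hcs.mul_right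
      simp_rw [hg]
      exact hcφ.mul (by fun_prop))
    (by
      refine Continuous.integrable_of_hasCompactSupport ?_ hcs.mul_right
      exact hcφ.mul (by fun_prop))
    (fun z _ => (hφ z).differentiableAt)
    (fun z _ => (hasFDerivAt_gaussian z).differentiableAt)
  simp_rw [hd, hg, mul_neg, neg_mul, integral_neg, mul_assoc, integral_const_mul] at h
  rw [gaussAvg]
  simp only [neg_mul]
  linarith

theorem integrable_norm_mul_gaussian (d : ℕ) : Integrable fun z : EuclideanSpace ℝ (Fin d) =>
    ‖z‖ * Real.exp (-(1 / 2) * ‖z‖ ^ 2) := by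
  refine (integrable_exp_neg_mul_norm_sq d (b := 1 / 4) (by norm_num)).mono'
    (by fun_prop) (Filter.Eventually.of_forall fun z => ?_)
  rw [Real.norm_of_nonneg (by positivity)]
  exact norm_mul_exp_le z

theorem integrable_mul_gaussian {h : EuclideanSpace ℝ (Fin d) → ℝ} (hc : Continuous h) {M : ℝ}
    (hM : ∀ z, |h z| ≤ M) : Integrable fun z => h z * Real.exp (-(1 / 2) * ‖z‖ ^ 2) :=
  (integrable_exp_neg_mul_norm_sq d (b := 1 / 2) (by norm_num)).bdd_mul
    hc.aestronglyMeasurable (Filter.Eventually.of_forall hM)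

theorem integrable_gaussAvg (hf : IsTestFun d f) (s : ℝ) (x : EuclideanSpace ℝ (Fin d)) :
    Integrable fun z => f (s ^ 2, x - s • z) * Real.exp (-(1 / 2) * ‖z‖ ^ 2) := by
  obtain ⟨M, hM⟩ := hf.exists_bound
  exact integrable_mul_gaussian (hf.continuous.comp (by fun_prop)) fun z => hM _

theorem integrable_mul_inner_mul_gaussian (hf : IsTestFun d f) (s : ℝ)
    (x e : EuclideanSpace ℝ (Fin d)) :
    Integrable fun z => f (s ^ 2, x - s • z) *
      (inner ℝ z e * Real.exp (-(1 / 2) * ‖z‖ ^ 2)) := by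
  obtain ⟨M, hM⟩ := hf.exists_bound
  refine Integrable.bdd_mul (c := M) ?_ ?_ (Filter.Eventually.of_forall fun z => hM _)
  · refine ((integrable_norm_mul_gaussian d).const_mul ‖e‖).mono' (by fun_prop)
      (Filter.Eventually.of_forall fun z => ?_)
    rw [norm_mul, Real.norm_of_nonneg (Real.exp_nonneg _), ← mul_assoc, mul_comm ‖e‖]
    gcongr
    exact norm_inner_le_norm z e
  · exact (hf.continuous.comp (by fun_prop)).aestronglyMeasurable

theorem hasDerivAt_gaussAvg_aux (hf : IsTestFun d f) (x : EuclideanSpace ℝ (Fin d)) (s : ℝ) :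
    HasDerivAt (fun s => gaussAvg d f s x)
      (∫ z, fderiv ℝ f (s ^ 2, x - s • z) (2 * s, -z) * Real.exp (-(1 / 2) * ‖z‖ ^ 2)) s := by
  obtain ⟨M, hM0, hM⟩ := hf.exists_bound_fderiv
  have hc : Continuous (fderiv ℝ f) := hf.1.continuous_fderiv (by simp)
  refine (hasDerivAt_integral_of_dominated_loc_of_deriv_le (ball_mem_nhds s one_pos)
    (F := fun s z => f (s ^ 2, x - s • z) * Real.exp (-(1 / 2) * ‖z‖ ^ 2))
    (F' := fun s z => fderiv ℝ f (s ^ 2, x - s • z) (2 * s, -z) *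
      Real.exp (-(1 / 2) * ‖z‖ ^ 2))
    (bound := fun z => M * (2 * (|s| + 1)) * Real.exp (-(1 / 2) * ‖z‖ ^ 2) +
      M * (‖z‖ * Real.exp (-(1 / 2) * ‖z‖ ^ 2)))
    ?_ (integrable_gaussAvg hf s x) ?_ ?_ ?_ ?_).2
  · exact Filter.Eventually.of_forall fun s => (integrable_gaussAvg hf s x).aestronglyMeasurable
  · have h1 : Continuous fun z => fderiv ℝ f (s ^ 2, x - s • z) :=
      hc.comp (by fun_prop)
    have h2 : Continuous fun z : EuclideanSpace ℝ (Fin d) => (2 * s, -z) := by fun_prop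
    exact ((h1.clm_apply h2).mul (by fun_prop)).aestronglyMeasurable
  · refine Filter.Eventually.of_forall fun z t ht => ?_
    rw [norm_mul, Real.norm_of_nonneg (Real.exp_nonneg _), ← mul_assoc M ‖z‖, ← add_mul]
    gcongr
    have hts : |t| ≤ |s| + 1 := by
      rw [mem_ball, Real.dist_eq] at ht
      have := abs_sub_abs_le_abs_sub t s
      linarith
    calc ‖fderiv ℝ f (t ^ 2, x - t • z) (2 * t, -z)‖
        ≤ M * ‖((2 * t, -z) : ℝ × EuclideanSpace ℝ (Fin d))‖ :=
          ContinuousLinearMap.le_of_opNorm_le _ (hM _) _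
      _ ≤ M * (2 * (|s| + 1) + ‖z‖) := by
          gcongr
          rw [Prod.norm_def]
          refine max_le ?_ ?_
          · simp only [norm_mul, Real.norm_eq_abs, Nat.abs_ofNat]
            have := norm_nonneg z
            linarith
          · simp only [norm_neg]
            have := abs_nonneg s
            linarith
      _ = _ := by ring
  · exact ((integrable_exp_neg_mul_norm_sq d (b := 1 / 2) (by norm_num)).const_mul _).add
      ((integrable_norm_mul_gaussian d).const_mul M)
  · refine Filter.Eventually.of_forall fun z t _ => ?_
    refine HasDerivAt.mul_const ?_ _
    have h1 : HasDerivAt (fun t : ℝ => (t ^ 2, x - t • z)) (2 * t, -z) t := by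
      refine HasDerivAt.prodMk ?_ ?_
      · simpa using hasDerivAt_pow 2 t
      · simpa using ((hasDerivAt_id t).smul_const z).const_sub x
    exact (hf.differentiable _).hasFDerivAt.comp_hasDerivAt t h1

theorem fderiv_apply_eq_sum (z : ℝ × EuclideanSpace ℝ (Fin d)) (a : ℝ)
    (y : EuclideanSpace ℝ (Fin d)) :
    fderiv ℝ f z (a, -y) = a * dirDeriv d (1, 0) f z -
      ∑ i : Fin d, inner ℝ y (EuclideanSpace.single i 1) *
        dirDeriv d (0, EuclideanSpace.single i 1) f z := by
  have h1 : ((a, -y) : ℝ × EuclideanSpace ℝ (Fin d)) =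
      a • ((1 : ℝ), (0 : EuclideanSpace ℝ (Fin d))) -
        ContinuousLinearMap.inr ℝ ℝ (EuclideanSpace ℝ (Fin d)) y := by
    simp
  have h2 : y = ∑ i : Fin d, (y i) • EuclideanSpace.single i (1 : ℝ) := by
    have := (EuclideanSpace.basisFun (Fin d) ℝ).sum_repr y
    simpa using this.symm
  rw [h1, map_sub, map_smul, smul_eq_mul]
  nth_rw 1 [h2]
  rw [map_sum, map_sum]
  simp only [map_smul]
  simp [dirDeriv, EuclideanSpace.inner_single_right]

/-- The average `gaussAvg d f s x` solves a heat-type equation in `s`. -/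
theorem hasDerivAt_gaussAvg (hf : IsTestFun d f) (x : EuclideanSpace ℝ (Fin d)) {s : ℝ}
    (hs : s ≠ 0) :
    HasDerivAt (fun s => gaussAvg d f s x) (2 * s * gaussAvg d (backwardHeat d f) s x) s := by
  convert hasDerivAt_gaussAvg_aux hf x s using 1
  set w : EuclideanSpace ℝ (Fin d) → ℝ := fun z => Real.exp (-(1 / 2) * ‖z‖ ^ 2) with hw
  let e : Fin d → EuclideanSpace ℝ (Fin d) := fun i => EuclideanSpace.single i 1
  have hi : ∀ i, Integrable fun z => 1 / 2 * (dirDeriv d (0, e i) (dirDeriv d (0, e i) f)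
      (s ^ 2, x - s • z) * w z) := fun i =>
    (integrable_gaussAvg ((hf.dirDeriv _).dirDeriv _) s x).const_mul _
  have hj : ∀ i, Integrable fun z => dirDeriv d (0, e i) f (s ^ 2, x - s • z) *
      (inner ℝ z (e i) * w z) := fun i =>
    integrable_mul_inner_mul_gaussian (hf.dirDeriv _) s x _
  have h1 : gaussAvg d (backwardHeat d f) s x = gaussAvg d (dirDeriv d (1, 0) f) s x +
      ∑ i, 1 / 2 * gaussAvg d (dirDeriv d (0, e i) (dirDeriv d (0, e i) f)) s x := by
    simp only [gaussAvg]
    simp_rw [← integral_const_mul]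
    rw [← integral_finsetSum _ fun i _ => hi i, ← integral_add
      (integrable_gaussAvg (hf.dirDeriv _) s x) (integrable_finsetSum _ fun i _ => hi i)]
    refine integral_congr_ae (Filter.Eventually.of_forall fun z => ?_)
    simp only [backwardHeat, halfLaplacian, add_mul, Finset.sum_mul, mul_assoc, e, w]
  have h2 : ∫ z, fderiv ℝ f (s ^ 2, x - s • z) (2 * s, -z) * w z =
      2 * s * gaussAvg d (dirDeriv d (1, 0) f) s x -
        ∑ i, ∫ z, dirDeriv d (0, e i) f (s ^ 2, x - s • z) * (inner ℝ z (e i) * w z) := by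
    rw [← integral_finsetSum _ fun i _ => hj i, gaussAvg, ← integral_const_mul, ← integral_sub
      ((integrable_gaussAvg (hf.dirDeriv _) s x).const_mul _)
      (integrable_finsetSum _ fun i _ => hj i)]
    refine integral_congr_ae (Filter.Eventually.of_forall fun z => ?_)
    simp only [fderiv_apply_eq_sum, sub_mul, Finset.sum_mul, e, w]
    congr 1
    · ring
    · exact Finset.sum_congr rfl fun i _ => by ring
  rw [h2, h1, mul_add, sub_eq_add_neg, ← Finset.sum_neg_distrib, Finset.mul_sum]
  congr 1
  refine Finset.sum_congr rfl fun i _ => ?_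
  rw [← smul_gaussAvg_dirDeriv (hf.dirDeriv _) hs x (e i)]
  ring

theorem continuous_gaussAvg (hf : IsTestFun d f) (x : EuclideanSpace ℝ (Fin d)) :
    Continuous fun s => gaussAvg d f s x :=
  continuous_iff_continuousAt.2 fun s => (hasDerivAt_gaussAvg_aux hf x s).continuousAt

/-- Representation of the initial trace through Gaussian averages. -/
theorem integral_gaussian_mul_eq (hf : IsTestFun d f) (x : EuclideanSpace ℝ (Fin d)) {T : ℝ}
    (hT : 0 < T) :
    f (0, x) * (∫ z : EuclideanSpace ℝ (Fin d), Real.exp (-(1 / 2) * ‖z‖ ^ 2)) =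
      ∫ t in (0 : ℝ)..T, (T⁻¹ * gaussAvg d f (√t) x -
        (1 - T⁻¹ * t) * gaussAvg d (backwardHeat d f) (√t) x) := by
  have hc := (continuous_gaussAvg hf x).comp Real.continuous_sqrt
  have hc' := (continuous_gaussAvg hf.backwardHeat x).comp Real.continuous_sqrt
  have hF := intervalIntegral.integral_eq_sub_of_hasDerivAt_of_le hT.le
    (f := fun t => (T⁻¹ * t - 1) * gaussAvg d f (√t) x)
    (f' := fun t => T⁻¹ * gaussAvg d f (√t) x -
        (1 - T⁻¹ * t) * gaussAvg d (backwardHeat d f) (√t) x)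
    (Continuous.continuousOn (by fun_prop))
    (fun t ht => by
      have ht0 : 0 < t := ht.1
      have hs : √t ≠ 0 := (Real.sqrt_pos.2 ht0).ne'
      have h1 := ((hasDerivAt_id t).const_mul T⁻¹).sub_const 1
      have h2 := (hasDerivAt_gaussAvg hf x hs).comp t (Real.hasDerivAt_sqrt ht0.ne')
      refine (h1.mul h2).congr_deriv ?_
      simp only [Function.comp, id]
      field_simp
      ring)
    (Continuous.intervalIntegrable (by fun_prop) _ _)
  rw [hF]
  simp [gaussAvg, inv_mul_cancel₀ hT.ne', integral_const_mul]

theorem ofReal_abs_integral_le {h : EuclideanSpace ℝ (Fin d) → ℝ}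
    {k : EuclideanSpace ℝ (Fin d) → ℝ} (hk : ∀ z, |k z| ≤ Real.exp (-(1 / 4) * ‖z‖ ^ 2)) :
    ENNReal.ofReal |∫ z, h z * k z| ≤
      ∫⁻ z, ENNReal.ofReal |h z| * gaussKernel d z := by
  rw [← Real.enorm_eq_ofReal_abs]
  refine (enorm_integral_le_lintegral_enorm _).trans (lintegral_mono fun z => ?_)
  rw [enorm_mul, Real.enorm_eq_ofReal_abs, Real.enorm_eq_ofReal_abs, gaussKernel]
  gcongr
  exact hk z

theorem ofReal_abs_gaussAvg_le (f : ℝ × EuclideanSpace ℝ (Fin d) → ℝ) {t : ℝ} (ht : 0 < t)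
    (x : EuclideanSpace ℝ (Fin d)) :
    ENNReal.ofReal |gaussAvg d f (√t) x| ≤
      ∫⁻ z, ENNReal.ofReal |f (t, x - √t • z)| * gaussKernel d z := by
  rw [gaussAvg, Real.sq_sqrt ht.le]
  refine ofReal_abs_integral_le fun z => ?_
  rw [abs_of_pos (Real.exp_pos _)]
  exact exp_half_le z

theorem ofReal_abs_gaussAvg_dirDeriv_le (hf : IsTestFun d f) {t : ℝ} (ht : 0 < t)
    (x : EuclideanSpace ℝ (Fin d)) {e : EuclideanSpace ℝ (Fin d)} (he : ‖e‖ = 1) :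
    ENNReal.ofReal |gaussAvg d (dirDeriv d (0, e) f) (√t) x| ≤
      ENNReal.ofReal (t ^ (-(1 / 2 : ℝ))) *
        ∫⁻ z, ENNReal.ofReal |f (t, x - √t • z)| * gaussKernel d z := by
  have hs : 0 < √t := Real.sqrt_pos.2 ht
  have h := smul_gaussAvg_dirDeriv hf hs.ne' x e
  rw [Real.sq_sqrt ht.le] at h
  have h' : |gaussAvg d (dirDeriv d (0, e) f) (√t) x| = t ^ (-(1 / 2 : ℝ)) *
      |∫ z, f (t, x - √t • z) * (inner ℝ z e * Real.exp (-(1 / 2) * ‖z‖ ^ 2))| := by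
    rw [← abs_neg (∫ z, _), ← h, abs_mul, abs_of_pos hs, Real.rpow_neg ht.le,
      ← Real.sqrt_eq_rpow, inv_mul_cancel_left₀ hs.ne']
  rw [h', ENNReal.ofReal_mul (by positivity)]
  gcongr
  refine ofReal_abs_integral_le fun z => ?_
  rw [abs_mul, abs_of_pos (Real.exp_pos _)]
  refine le_trans ?_ (norm_mul_exp_le z)
  gcongr
  simpa [he] using abs_real_inner_le_norm z e

theorem ofReal_abs_trace_le (hf : IsTestFun d f) (x : EuclideanSpace ℝ (Fin d)) {T : ℝ}
    (hT : 0 < T) {c : ℝ}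
    (hc : c = ∫ z : EuclideanSpace ℝ (Fin d), Real.exp (-(1 / 2) * ‖z‖ ^ 2)) (hc0 : 0 < c) :
    ENNReal.ofReal (c * |f (0, x)|) ≤ ∫⁻ t in Ioo 0 T,
      (ENNReal.ofReal T⁻¹ * ENNReal.ofReal |gaussAvg d f (√t) x| +
        ENNReal.ofReal |gaussAvg d (backwardHeat d f) (√t) x|) := by
  have h := integral_gaussian_mul_eq hf x hT
  rw [← hc, intervalIntegral.integral_of_le hT.le, integral_Ioc_eq_integral_Ioo] at h
  have h2 : c * |f (0, x)| = |f (0, x) * c| := by rw [abs_mul, abs_of_pos hc0, mul_comm]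
  rw [h2, h, ← Real.enorm_eq_ofReal_abs]
  refine (enorm_integral_le_lintegral_enorm _).trans
    (setLIntegral_mono' measurableSet_Ioo fun t ht => ?_)
  have hTt : 0 ≤ 1 - T⁻¹ * t ∧ 1 - T⁻¹ * t ≤ 1 := by
    have h1 : T⁻¹ * t ≤ T⁻¹ * T := by gcongr; exact ht.2.le
    rw [inv_mul_cancel₀ hT.ne'] at h1
    have h3 : 0 ≤ T⁻¹ * t := mul_nonneg (by positivity) ht.1.le
    constructor <;> linarith
  rw [Real.enorm_eq_ofReal_abs, ← ENNReal.ofReal_mul (by positivity),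
    ← ENNReal.ofReal_add (by positivity) (abs_nonneg _)]
  gcongr
  refine (abs_sub _ _).trans ?_
  rw [abs_mul, abs_mul, abs_of_pos (inv_pos.2 hT), abs_of_nonneg hTt.1]
  gcongr
  exact mul_le_of_le_one_left (abs_nonneg _) hTt.2

end Avg

/-- Pointwise bound of the trace by Gaussian potentials. -/
theorem ofReal_abs_traceD_le {d : ℕ} {γ : ℕ} (hγ : γ = 0 ∨ γ = 1)
    {u : ℝ × EuclideanSpace ℝ (Fin d) → ℝ} (hu : IsTestFun d u) {T : ℝ} (hT : 0 < T) {c : ℝ}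
    (hc : c = ∫ z : EuclideanSpace ℝ (Fin d), Real.exp (-(1 / 2) * ‖z‖ ^ 2)) (hc0 : 0 < c)
    (x : EuclideanSpace ℝ (Fin d)) :
    ENNReal.ofReal c * ENNReal.ofReal |traceD d γ u x| ≤
      heatPotential d γ T (fun z => ENNReal.ofReal T⁻¹ * ENNReal.ofReal |u z| +
        ENNReal.ofReal |backwardHeat d u z|) x := by
  have hmeas : ∀ t : ℝ, Measurable fun z => ENNReal.ofReal |u (t, x - √t • z)| *
      gaussKernel d z := fun t =>
    (hu.continuous.comp (by fun_prop : Continuous fun z => (t, x - √t • z))).abs.measurable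
      |>.ennreal_ofReal.mul (measurable_gaussKernel d)
  have hsum : ∀ t : ℝ, ∫⁻ z, (ENNReal.ofReal T⁻¹ * ENNReal.ofReal |u (t, x - √t • z)| +
        ENNReal.ofReal |backwardHeat d u (t, x - √t • z)|) * gaussKernel d z =
      ENNReal.ofReal T⁻¹ * (∫⁻ z, ENNReal.ofReal |u (t, x - √t • z)| * gaussKernel d z) +
        ∫⁻ z, ENNReal.ofReal |backwardHeat d u (t, x - √t • z)| * gaussKernel d z := by
    intro t
    rw [← lintegral_const_mul _ (hmeas t), ← lintegral_add_left ((hmeas t).const_mul _)]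
    simp only [add_mul, mul_assoc]
  rw [← ENNReal.ofReal_mul hc0.le]
  set B := heatPotential d γ T (fun z => ENNReal.ofReal T⁻¹ * ENNReal.ofReal |u z| +
        ENNReal.ofReal |backwardHeat d u z|) x with hB
  simp only [heatPotential, hsum] at hB
  rcases hγ with rfl | rfl
  · simp only [traceD, zero_ne_one, if_false]
    refine (ofReal_abs_trace_le hu x hT hc hc0).trans ?_
    rw [hB]
    refine setLIntegral_mono' measurableSet_Ioo fun t ht => ?_
    simp only [Nat.cast_zero, zero_div, neg_zero, Real.rpow_zero, ENNReal.ofReal_one, one_mul]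
    gcongr
    · exact ofReal_abs_gaussAvg_le u ht.1 x
    · exact ofReal_abs_gaussAvg_le _ ht.1 x
  · have key : ∀ e : EuclideanSpace ℝ (Fin d), ‖e‖ = 1 →
        ENNReal.ofReal (c * |dirDeriv d (0, e) u (0, x)|) ≤ B := by
      intro e he
      refine (ofReal_abs_trace_le (hu.dirDeriv (0, e)) x hT hc hc0).trans ?_
      rw [hB, hu.backwardHeat_dirDeriv]
      refine setLIntegral_mono' measurableSet_Ioo fun t ht => ?_
      rw [mul_add, mul_left_comm]
      simp only [Nat.cast_one]
      gcongr
      · exact ofReal_abs_gaussAvg_dirDeriv_le hu ht.1 x he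
      · exact ofReal_abs_gaussAvg_dirDeriv_le hu.backwardHeat ht.1 x he
    rcases eq_or_ne B ⊤ with hBt | hBt
    · rw [hBt]; exact le_top
    simp only [traceD, if_true, abs_norm]
    rw [ENNReal.ofReal_le_iff_le_toReal hBt, ← le_div_iff₀' hc0]
    refine ContinuousLinearMap.opNorm_le_of_unit_norm (by positivity) fun e he => ?_
    rw [le_div_iff₀' hc0, ← ENNReal.ofReal_le_iff_le_toReal hBt]
    have h1 : fderiv ℝ (fun y => u (0, y)) x e = dirDeriv d (0, e) u (0, x) := by
      have h2 : HasFDerivAt (fun y => u (0, y)) ((fderiv ℝ u (0, x)).comp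
          (ContinuousLinearMap.inr ℝ ℝ (EuclideanSpace ℝ (Fin d)))) x :=
        (hu.differentiable (0, x)).hasFDerivAt.comp x (hasFDerivAt_prodMk_right 0 x)
      rw [h2.fderiv]
      simp [dirDeriv]
    rw [h1, Real.norm_eq_abs]
    exact key e he

theorem mixedNorm_eq (d : ℕ) (p q : ℝ) (g : ℝ × EuclideanSpace ℝ (Fin d) → ℝ) :
    mixedNorm d p q g = lmixedNorm d p q fun z => ENNReal.ofReal |g z| := rfl

theorem lmixedNorm_mono {d : ℕ} {p q : ℝ} (hp : 0 < p) (hq : 0 < q)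
    {f g : ℝ × EuclideanSpace ℝ (Fin d) → ℝ≥0∞} (h : ∀ z, f z ≤ g z) :
    lmixedNorm d p q f ≤ lmixedNorm d p q g := by
  unfold lmixedNorm
  gcongr
  exact h _

theorem lmixedNorm_const_mul {d : ℕ} {p q : ℝ} (hp : 0 < p) (hq : 0 < q) {c : ℝ≥0∞} (hc : c ≠ ⊤)
    (g : ℝ × EuclideanSpace ℝ (Fin d) → ℝ≥0∞) :
    lmixedNorm d p q (fun z => c * g z) = c * lmixedNorm d p q g := by
  unfold lmixedNorm
  have hpq : 0 < q / p := div_pos hq hp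
  simp_rw [ENNReal.mul_rpow_of_nonneg _ _ hp.le]
  simp_rw [lintegral_const_mul' _ _ (ENNReal.rpow_ne_top_of_nonneg hp.le hc),
    ENNReal.mul_rpow_of_nonneg _ _ hpq.le, ← ENNReal.rpow_mul]
  rw [mul_div_cancel₀ _ hp.ne', lintegral_const_mul' _ _ (ENNReal.rpow_ne_top_of_nonneg hq.le hc),
    ENNReal.mul_rpow_of_nonneg _ _ (by positivity), one_div, ENNReal.rpow_rpow_inv hq.ne']

theorem dirDeriv_time_eq {d : ℕ} {u : ℝ × EuclideanSpace ℝ (Fin d) → ℝ} (hu : IsTestFun d u)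
    (z : ℝ × EuclideanSpace ℝ (Fin d)) : dirDeriv d (1, 0) u z = timeDeriv d u z := by
  have h : HasDerivAt (fun s => u (s, z.2)) (fderiv ℝ u z (1, 0)) z.1 :=
    (hu.differentiable (z.1, z.2)).hasFDerivAt.comp_hasDerivAt z.1
      ((hasDerivAt_id z.1).prodMk (hasDerivAt_const z.1 z.2))
  exact h.deriv.symm

theorem abs_halfLaplacian_le {d : ℕ} {u : ℝ × EuclideanSpace ℝ (Fin d) → ℝ} (hu : IsTestFun d u)
    (z : ℝ × EuclideanSpace ℝ (Fin d)) : |halfLaplacian d u z| ≤ d * spaceHessNorm d u z := by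
  let L := fderiv ℝ (fun y => fderiv ℝ (fun w => u (z.1, w)) y) z.2
  have hsp : ∀ {f : ℝ × EuclideanSpace ℝ (Fin d) → ℝ}, IsTestFun d f →
      ∀ e y, fderiv ℝ (fun w => f (z.1, w)) y e = dirDeriv d (0, e) f (z.1, y) := by
    intro f hf e y
    have h2 : HasFDerivAt (fun y => f (z.1, y)) ((fderiv ℝ f (z.1, y)).comp
        (ContinuousLinearMap.inr ℝ ℝ (EuclideanSpace ℝ (Fin d)))) y :=
      (hf.differentiable (z.1, y)).hasFDerivAt.comp y (hasFDerivAt_prodMk_right z.1 y)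
    rw [h2.fderiv]
    simp [dirDeriv]
  have hsmooth : ContDiff ℝ (⊤ : ℕ∞) fun w => u (z.1, w) :=
    hu.1.comp (contDiff_const.prodMk contDiff_id)
  have hdiff : Differentiable ℝ fun y => fderiv ℝ (fun w => u (z.1, w)) y :=
    (hsmooth.fderiv_right (m := (⊤ : ℕ∞)) (by simp)).differentiable (by simp)
  have hL : ∀ e, dirDeriv d (0, e) (dirDeriv d (0, e) u) z = L e e := by
    intro e
    have h3 := ((hdiff z.2).hasFDerivAt.clm_apply (hasFDerivAt_const e z.2)).fderiv
    have h4 := hsp (hu.dirDeriv (0, e)) e z.2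
    simp_rw [← hsp hu e, h3] at h4
    rw [← h4]
    simp [L]
  have hterm : ∀ i : Fin d, |1 / 2 * dirDeriv d (0, EuclideanSpace.single i 1)
      (dirDeriv d (0, EuclideanSpace.single i 1) u) z| ≤ spaceHessNorm d u z := by
    intro i
    rw [hL, abs_mul]
    have h5 := L.le_opNorm₂ (EuclideanSpace.single i 1) (EuclideanSpace.single i 1)
    simp only [PiLp.norm_single, norm_one, mul_one, Real.norm_eq_abs] at h5
    have h6 : |(1 / 2 : ℝ)| ≤ 1 := by rw [abs_of_pos] <;> norm_num
    exact (mul_le_mul h6 h5 (abs_nonneg _) zero_le_one).trans_eq (one_mul _)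
  refine (Finset.abs_sum_le_sum_abs _ _).trans ?_
  refine (Finset.sum_le_sum fun i _ => hterm i).trans_eq ?_
  simp

theorem heatPotential_add {d : ℕ} (γ : ℕ) (T : ℝ) {f g : ℝ × EuclideanSpace ℝ (Fin d) → ℝ≥0∞}
    (hf : Measurable f) (x : EuclideanSpace ℝ (Fin d)) :
    heatPotential d γ T (fun z => f z + g z) x =
      heatPotential d γ T f x + heatPotential d γ T g x := by
  have hm : Measurable fun t : ℝ => ENNReal.ofReal (t ^ (-(γ / 2 : ℝ))) *
      ∫⁻ z, f (t, x - √t • z) * gaussKernel d z :=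
    (measurable_heatPotential_inner d γ hf).comp measurable_prodMk_left
  unfold heatPotential
  rw [← lintegral_add_left hm]
  refine lintegral_congr fun t => ?_
  have hm' : Measurable fun z => f (t, x - √t • z) * gaussKernel d z :=
    (hf.comp (by fun_prop)).mul (measurable_gaussKernel d)
  simp only [add_mul]
  rw [lintegral_add_left hm', mul_add]

/-- Trace estimate at the parabolic scale `√T`. -/
theorem eLpNorm_traceD_le (d : ℕ) (γ : ℕ) (hγ : γ = 0 ∨ γ = 1) {p q r κ : ℝ} (hp : 1 < p)
    (hq : 1 < q) (hr : p ≤ r) (hκdef : κ = γ + d / p + 2 / q - d / r) (hκ : κ < 2) :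
    ∃ C : ℝ, 0 ≤ C ∧ ∀ u : ℝ × EuclideanSpace ℝ (Fin d) → ℝ, IsTestFun d u → ∀ T : ℝ, 0 < T →
      eLpNorm (traceD d γ u) (ENNReal.ofReal r) volume ≤
        ENNReal.ofReal (C * T ^ (1 - κ / 2)) *
          (ENNReal.ofReal T⁻¹ * mixedNorm d p q u + (mixedNorm d p q (timeDeriv d u) +
            d * mixedNorm d p q (spaceHessNorm d u))) := by
  obtain ⟨C, hC0, hC⟩ := exists_heatPotential_le d γ hp hq hr hκdef hκ
  have hp0 : 0 < p := by linarith
  have hq0 : 0 < q := by linarith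
  have hr0 : 0 < r := by linarith
  obtain ⟨c, hc⟩ : ∃ c, c = ∫ z : EuclideanSpace ℝ (Fin d), Real.exp (-(1 / 2) * ‖z‖ ^ 2) :=
    ⟨_, rfl⟩
  have hc0 : 0 < c := by
    rw [hc]
    exact integral_exp_pos (integrable_exp_neg_mul_norm_sq d (b := 1 / 2) (by norm_num))
  refine ⟨c⁻¹ * C, by positivity, fun u hu T hT => ?_⟩
  let g₁ : ℝ × EuclideanSpace ℝ (Fin d) → ℝ≥0∞ := fun z =>
    ENNReal.ofReal T⁻¹ * ENNReal.ofReal |u z|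
  let g₂ : ℝ × EuclideanSpace ℝ (Fin d) → ℝ≥0∞ := fun z =>
    ENNReal.ofReal |dirDeriv d (1, 0) u z|
  let g₃ : ℝ × EuclideanSpace ℝ (Fin d) → ℝ≥0∞ := fun z => ENNReal.ofReal |halfLaplacian d u z|
  have hg₁ : Measurable g₁ := hu.continuous.abs.measurable.ennreal_ofReal.const_mul _
  have hg₂ : Measurable g₂ := (hu.dirDeriv _).continuous.abs.measurable.ennreal_ofReal
  have hg₃ : Measurable g₃ := hu.halfLaplacian.continuous.abs.measurable.ennreal_ofReal
  have hN₁ : lmixedNorm d p q g₁ = ENNReal.ofReal T⁻¹ * mixedNorm d p q u :=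
    lmixedNorm_const_mul hp0 hq0 ENNReal.ofReal_ne_top _
  have hN₂ : lmixedNorm d p q g₂ = mixedNorm d p q (timeDeriv d u) := by
    simp only [g₂, dirDeriv_time_eq hu, mixedNorm_eq]
  have hN₃ : lmixedNorm d p q g₃ ≤ d * mixedNorm d p q (spaceHessNorm d u) := by
    rw [mixedNorm_eq, ← lmixedNorm_const_mul hp0 hq0 (natCast_ne_top d)]
    refine lmixedNorm_mono hp0 hq0 fun z => ?_
    rw [← ENNReal.ofReal_natCast, ← ENNReal.ofReal_mul (Nat.cast_nonneg d)]
    refine ENNReal.ofReal_le_ofReal ((abs_halfLaplacian_le hu z).trans ?_)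
    gcongr
    exact le_abs_self _
  have hpt : ∀ x, ENNReal.ofReal c * ENNReal.ofReal |traceD d γ u x| ≤
      heatPotential d γ T g₁ x + (heatPotential d γ T g₂ x + heatPotential d γ T g₃ x) := by
    intro x
    refine (ofReal_abs_traceD_le hγ hu hT hc hc0 x).trans ?_
    rw [← heatPotential_add γ T hg₂, ← heatPotential_add γ T hg₁]
    unfold heatPotential
    gcongr with t z
    simp only [g₁, g₂, g₃]
    gcongr
    rw [← ENNReal.ofReal_add (abs_nonneg _) (abs_nonneg _)]
    exact ENNReal.ofReal_le_ofReal (abs_add_le _ _)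
  have hmain : ENNReal.ofReal c * eLpNorm (traceD d γ u) (ENNReal.ofReal r) volume ≤
      ENNReal.ofReal (C * T ^ (1 - κ / 2)) *
          (ENNReal.ofReal T⁻¹ * mixedNorm d p q u + (mixedNorm d p q (timeDeriv d u) +
            d * mixedNorm d p q (spaceHessNorm d u))) := by
    rw [eLpNorm_eq_lintegral_rpow_enorm_toReal (by simpa using hr0) ENNReal.ofReal_ne_top,
      ENNReal.toReal_ofReal hr0.le]
    have e1 : ENNReal.ofReal c * (∫⁻ x, ‖traceD d γ u x‖ₑ ^ r) ^ (1 / r) =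
        (∫⁻ x, (ENNReal.ofReal c * ENNReal.ofReal |traceD d γ u x|) ^ r) ^ (1 / r) := by
      simp_rw [ENNReal.mul_rpow_of_nonneg _ _ hr0.le, Real.enorm_eq_ofReal_abs]
      rw [lintegral_const_mul' _ _ (ENNReal.rpow_ne_top_of_nonneg hr0.le ENNReal.ofReal_ne_top),
        ENNReal.mul_rpow_of_nonneg _ _ (by positivity), one_div, ENNReal.rpow_rpow_inv hr0.ne']
    have hM := fun {g} hg => (measurable_heatPotential d γ T (g := g) hg).aemeasurable (μ := volume)
    rw [e1]
    calc _ ≤ (∫⁻ x, (heatPotential d γ T g₁ x +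
          (heatPotential d γ T g₂ x + heatPotential d γ T g₃ x)) ^ r) ^ (1 / r) := by
          gcongr with x
          exact hpt x
      _ ≤ (∫⁻ x, heatPotential d γ T g₁ x ^ r) ^ (1 / r) +
          (∫⁻ x, (heatPotential d γ T g₂ x + heatPotential d γ T g₃ x) ^ r) ^ (1 / r) :=
          ENNReal.lintegral_Lp_add_le (hM hg₁) ((hM hg₂).add (hM hg₃)) (by linarith)
      _ ≤ (∫⁻ x, heatPotential d γ T g₁ x ^ r) ^ (1 / r) +
          ((∫⁻ x, heatPotential d γ T g₂ x ^ r) ^ (1 / r) +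
            (∫⁻ x, heatPotential d γ T g₃ x ^ r) ^ (1 / r)) := by
          gcongr
          exact ENNReal.lintegral_Lp_add_le (hM hg₂) (hM hg₃) (by linarith)
      _ ≤ _ := by
          rw [mul_add, mul_add]
          gcongr
          · exact (hC T hT g₁ hg₁).trans_eq (by rw [hN₁])
          · exact (hC T hT g₂ hg₂).trans_eq (by rw [hN₂])
          · exact (hC T hT g₃ hg₃).trans (by gcongr)
  have hinv : ENNReal.ofReal c⁻¹ * ENNReal.ofReal c = 1 := by
    rw [← ENNReal.ofReal_mul (by positivity), inv_mul_cancel₀ hc0.ne', ENNReal.ofReal_one]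
  calc eLpNorm (traceD d γ u) (ENNReal.ofReal r) volume
      = ENNReal.ofReal c⁻¹ *
          (ENNReal.ofReal c * eLpNorm (traceD d γ u) (ENNReal.ofReal r) volume) := by
        rw [← mul_assoc, hinv, one_mul]
    _ ≤ _ := mul_le_mul_right hmain _
    _ = _ := by rw [← mul_assoc, ← ENNReal.ofReal_mul (by positivity), mul_assoc c⁻¹]

/-- Trace estimate in mixed-norm spaces:
`‖D^γ u(0,·)‖_{L_r} ≤ N ε (‖∂_t u‖_{L_{p,q}} + ‖D²u‖_{L_{p,q}}) + N ε^{-κ/(2-κ)} ‖u‖_{L_{p,q}}`. -/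
theorem trace_mixed_norm (d : ℕ) (hd : 2 ≤ d) (γ : ℕ) (hγ : γ = 0 ∨ γ = 1)
    (p q r : ℝ) (hp : 1 < p) (hq : 1 < q) (hr : p ≤ r)
    (κ : ℝ) (hκdef : κ = γ + d / p + 2 / q - d / r) (hκ : κ < 2) :
    ∃ N : ℝ, 0 < N ∧
      ∀ u : ℝ × EuclideanSpace ℝ (Fin d) → ℝ,
        ContDiff ℝ (⊤ : ℕ∞) u → HasCompactSupport u →
        ∀ ε : ℝ, 0 < ε →
          eLpNorm (traceD d γ u) (ENNReal.ofReal r) volume ≤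
            ENNReal.ofReal (N * ε) *
                (mixedNorm d p q (timeDeriv d u) + mixedNorm d p q (spaceHessNorm d u)) +
              ENNReal.ofReal (N * ε ^ (-(κ / (2 - κ)))) * mixedNorm d p q u := by
  obtain ⟨C, hC0, hC⟩ := eLpNorm_traceD_le d γ hγ hp hq hr hκdef hκ
  have hκ2 : 0 < 2 - κ := by linarith
  have hd1 : (1 : ℝ) ≤ d := by exact_mod_cast (by omega : 1 ≤ d)
  refine ⟨(C + 1) * d, by positivity, fun u hu hcs ε hε => ?_⟩
  set T := ε ^ (2 / (2 - κ))
  have hT : 0 < T := Real.rpow_pos_of_pos hε _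
  have hT1 : T ^ (1 - κ / 2) = ε := by
    rw [← Real.rpow_mul hε.le, show 2 / (2 - κ) * (1 - κ / 2) = 1 by field_simp, Real.rpow_one]
  have hT2 : ε * T⁻¹ = ε ^ (-(κ / (2 - κ))) := by
    rw [← Real.rpow_neg hε.le]
    nth_rw 1 [← Real.rpow_one ε]
    rw [← Real.rpow_add hε]
    congr 1
    field_simp
    ring
  refine (hC u ⟨hu, hcs⟩ T hT).trans ?_
  rw [hT1, mul_add, add_comm]
  have hCd : C ≤ (C + 1) * d := by nlinarith
  have hCd' : C * d ≤ (C + 1) * d := by nlinarith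
  gcongr ?_ + ?_
  · rw [mul_add, mul_add, ← mul_assoc, ← ENNReal.ofReal_natCast,
      ← ENNReal.ofReal_mul (by positivity)]
    gcongr ENNReal.ofReal ?_ * _ + ENNReal.ofReal ?_ * _
    · gcongr
    · rw [mul_right_comm]
      gcongr
  · rw [← mul_assoc, ← ENNReal.ofReal_mul (by positivity), mul_assoc, hT2]
    gcongr
end
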